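/- arXiv:2305.05283 — 2 statements merged into one kernel-verified Lean document; each statement's English description precedes it below -/
import Mathlib

section
/- For every constant C ≥ 1 there exists ε > 0 with the following property: for every Euclidean triangle T with p(α_T) < ε, every center x₀ ∈ ℝ² and every r > 10 · diam(T), there exists a measurable set F ⊂ B(x₀, r) of positive Lebesgue measure such that |{x ∈ ℝ² : M_{L_r(T)} 1_F(x) ≥ 1/4}| ≥ C · |F|. -/
open MeasureTheory Metric Real EuclideanGeometry
open scoped ENNReal

/-- The maximal operator associated to a family `ℬ` of sets:
`M_ℬ f (x) = sup { μ(T)⁻¹ ∫_T |f| dμ : T ∈ ℬ, x ∈ T }` (with value `0` when no member of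
`ℬ` contains `x`). -/
noncomputable def maximalFn {X : Type*} [MeasurableSpace X] (μ : Measure X)
    (ℬ : Set (Set X)) (f : X → ℝ) (x : X) : ℝ≥0∞ :=
  ⨆ (T : Set X) (_ : T ∈ ℬ) (_ : x ∈ T), (μ T)⁻¹ * ∫⁻ y in T, ‖f y‖₊ ∂μ

/-- The Euclidean plane `ℝ²`. -/
abbrev Plane := EuclideanSpace ℝ (Fin 2)

/-- The local family `L_r(T)`: all images of `T` under Euclidean isometries that are
contained in the ball `B(x₀, r)`. -/
def localFamily (T : Set Plane) (x₀ : Plane) (r : ℝ) : Set (Set Plane) :=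
  {T' | (∃ g : Plane ≃ᵢ Plane, T' = g '' T) ∧ T' ⊆ ball x₀ r}

/-! ### Dyadic bush of lines -/

/-- The abscissa, as a proportion of the base length, around which the `j`-th binary digit of the
slope is compressed. -/
noncomputable def pivot (m j : ℕ) : ℝ := (min j m : ℕ) / (2 * m)

/-- Slope of the line coded by the set `S` of its nonzero binary digits. -/
noncomputable def bushSlope (S : Finset ℕ) : ℝ := ∑ j ∈ S, (1 / 2 : ℝ) ^ (j + 1)

/-- Height at abscissa `x` of the line coded by `S`. -/
noncomputable def bushLine (d : ℝ) (m : ℕ) (S : Finset ℕ) (x : ℝ) : ℝ :=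
  ∑ j ∈ S, (1 / 2 : ℝ) ^ (j + 1) * (x - d * pivot m j)

theorem bushLine_eq (d : ℝ) (m : ℕ) (S : Finset ℕ) (x : ℝ) :
    bushLine d m S x = bushSlope S * x + bushLine d m S 0 := by
  simp only [bushLine, bushSlope, Finset.sum_mul, ← Finset.sum_add_distrib]
  exact Finset.sum_congr rfl fun j _ => by ring

theorem pivot_nonneg (m j : ℕ) : 0 ≤ pivot m j := by unfold pivot; positivity

theorem pivot_le_half (m j : ℕ) : pivot m j ≤ 1 / 2 := by
  unfold pivot
  rcases Nat.eq_zero_or_pos m with rfl | hm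
  · simp
  · have hm' : (0 : ℝ) < m := by exact_mod_cast hm
    rw [div_le_iff₀ (by positivity)]
    have : ((min j m : ℕ) : ℝ) ≤ m := by exact_mod_cast min_le_right j m
    linarith

theorem pivot_mono (m : ℕ) : Monotone (pivot m) := by
  intro i j hij
  unfold pivot
  gcongr

theorem pivot_sub_le {m : ℕ} (hm : 0 < m) (k i : ℕ) :
    pivot m (k + i) - pivot m k ≤ i / m := by
  have hm' : (0 : ℝ) < m := by exact_mod_cast hm
  have h : min (k + i) m ≤ min k m + i := by omega
  have h' : ((min (k + i) m : ℕ) : ℝ) ≤ (min k m : ℕ) + i := by exact_mod_cast h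
  unfold pivot
  rw [← sub_div, div_le_div_iff₀ (by positivity) hm']
  nlinarith [(Nat.cast_nonneg i : (0 : ℝ) ≤ i)]

theorem sum_half_pow (n : ℕ) :
    ∑ j ∈ Finset.range n, (1 / 2 : ℝ) ^ (j + 1) = 1 - (1 / 2) ^ n := by
  induction n with
  | zero => simp
  | succ n ih => rw [Finset.sum_range_succ, ih]; ring

theorem sum_succ_mul_half_pow_le (n : ℕ) :
    ∑ j ∈ Finset.range n, (1 / 2 : ℝ) ^ (j + 1) * (1 + j) ≤ 2 := by
  have h : ∑ j ∈ Finset.range n, (1 / 2 : ℝ) ^ (j + 1) * (1 + j) = 2 - (n + 2) * (1 / 2) ^ n := by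
    induction n with
    | zero => simp
    | succ n ih => rw [Finset.sum_range_succ, ih]; push_cast; ring
  rw [h]
  have : (0 : ℝ) ≤ (n + 2) * (1 / 2) ^ n := by positivity
  linarith

theorem bushSlope_nonneg (S : Finset ℕ) : 0 ≤ bushSlope S :=
  Finset.sum_nonneg fun _ _ => by positivity

theorem bushSlope_le_one {n : ℕ} {S : Finset ℕ} (hS : S ⊆ Finset.range n) : bushSlope S ≤ 1 := by
  have h := Finset.sum_le_sum_of_subset_of_nonneg (f := fun j => (1 / 2 : ℝ) ^ (j + 1)) hS
    fun _ _ _ => by positivity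
  rw [sum_half_pow] at h
  have : (0 : ℝ) ≤ (1 / 2) ^ n := by positivity
  unfold bushSlope
  linarith

theorem abs_bushLine_zero_le {d : ℝ} (hd : 0 ≤ d) {n m : ℕ} {S : Finset ℕ}
    (hS : S ⊆ Finset.range n) : |bushLine d m S 0| ≤ d / 2 := by
  calc |bushLine d m S 0|
      ≤ ∑ j ∈ S, |(1 / 2 : ℝ) ^ (j + 1) * (0 - d * pivot m j)| := Finset.abs_sum_le_sum_abs _ _
    _ ≤ ∑ j ∈ S, (1 / 2 : ℝ) ^ (j + 1) * (d / 2) := by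
      refine Finset.sum_le_sum fun j _ => ?_
      rw [abs_mul, abs_of_nonneg (by positivity : (0 : ℝ) ≤ (1 / 2) ^ (j + 1)), zero_sub, abs_neg,
        abs_of_nonneg (mul_nonneg hd (pivot_nonneg m j))]
      have := mul_le_mul_of_nonneg_left (pivot_le_half m j) hd
      gcongr
      linarith
    _ = bushSlope S * (d / 2) := by rw [bushSlope, Finset.sum_mul]
    _ ≤ d / 2 := by nlinarith [bushSlope_le_one hS]

/-- Signed dyadic sums with nonincreasing weights are separated. -/
theorem le_abs_sum_half_pow (n : ℕ) (w : ℕ → ℝ) (e : ℕ → ℝ) (ω : ℝ) (hω : 0 ≤ ω)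
    (hw : Antitone w) (hωw : ∀ j, ω ≤ w j) (he : ∀ j, e j = 0 ∨ |e j| = 1)
    (hne : ∃ j < n, e j ≠ 0) :
    ω * (1 / 2) ^ n ≤ |∑ j ∈ Finset.range n, e j * ((1 / 2 : ℝ) ^ (j + 1) * w j)| := by
  induction n generalizing w e with
  | zero => simp at hne
  | succ n ih =>
    rw [Finset.sum_range_succ']
    have hshift : ∑ j ∈ Finset.range n, e (j + 1) * ((1 / 2 : ℝ) ^ (j + 1 + 1) * w (j + 1)) =
        1 / 2 * ∑ j ∈ Finset.range n, e (j + 1) * ((1 / 2 : ℝ) ^ (j + 1) * w (j + 1)) := by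
      rw [Finset.mul_sum]
      exact Finset.sum_congr rfl fun j _ => by ring
    rw [hshift]
    rcases he 0 with h0 | h0
    · have hne' : ∃ j < n, e (j + 1) ≠ 0 := by
        obtain ⟨j, hj, hej⟩ := hne
        cases j with
        | zero => exact absurd h0 hej
        | succ j => exact ⟨j, by omega, hej⟩
      have := ih (fun j => w (j + 1)) (fun j => e (j + 1)) (fun i j hij => hw (by omega))
        (fun j => hωw _) (fun j => he _) hne'
      rw [h0, zero_mul, add_zero, abs_mul, abs_of_pos (by norm_num : (0 : ℝ) < 1 / 2), pow_succ]
      linarith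
    · have hw0 : 0 ≤ w 0 := hω.trans (hωw 0)
      have htail : |∑ j ∈ Finset.range n, e (j + 1) * ((1 / 2 : ℝ) ^ (j + 1) * w (j + 1))| ≤
          (1 - (1 / 2) ^ n) * w 0 := by
        rw [← sum_half_pow, Finset.sum_mul]
        refine (Finset.abs_sum_le_sum_abs _ _).trans (Finset.sum_le_sum fun j _ => ?_)
        have he1 : |e (j + 1)| ≤ 1 := by
          rcases he (j + 1) with h | h
          · simp [h]
          · exact h.le
        have hw1 : 0 ≤ w (j + 1) := hω.trans (hωw _)
        rw [abs_mul, abs_of_nonneg (by positivity : (0 : ℝ) ≤ (1 / 2) ^ (j + 1) * w (j + 1))]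
        have : (1 / 2 : ℝ) ^ (j + 1) * w (j + 1) ≤ (1 / 2) ^ (j + 1) * w 0 := by
          gcongr
          exact hw (Nat.zero_le _)
        nlinarith [abs_nonneg (e (j + 1)),
          (by positivity : (0 : ℝ) ≤ (1 / 2) ^ (j + 1) * w (j + 1))]
      have hhead : |e 0 * ((1 / 2 : ℝ) ^ (0 + 1) * w 0)| = 1 / 2 * w 0 := by
        rw [abs_mul, h0, abs_of_nonneg (by positivity)]
        ring
      have htri := abs_sub_abs_le_abs_sub (e 0 * ((1 / 2 : ℝ) ^ (0 + 1) * w 0))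
        (-(1 / 2 * ∑ j ∈ Finset.range n, e (j + 1) * ((1 / 2 : ℝ) ^ (j + 1) * w (j + 1))))
      rw [hhead, abs_neg, abs_mul, abs_of_pos (by norm_num : (0 : ℝ) < 1 / 2), sub_neg_eq_add,
        add_comm (e 0 * _)] at htri
      refine le_trans ?_ htri
      have : ω * (1 / 2) ^ n ≤ w 0 * (1 / 2) ^ n := by
        gcongr
        exact hωw 0
      rw [pow_succ]
      linarith

/-- Distinct lines of the bush are far apart to the right of all the pivots. -/
theorem le_abs_bushLine_sub {d x ω : ℝ} (hd : 0 ≤ d) (hω : 0 ≤ ω) (hx : d / 2 + ω ≤ x)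
    {n m : ℕ} {S S' : Finset ℕ} (hS : S ⊆ Finset.range n) (hS' : S' ⊆ Finset.range n)
    (hne : S ≠ S') :
    ω * (1 / 2) ^ n ≤ |bushLine d m S x - bushLine d m S' x| := by
  classical
  have hsum : ∀ U : Finset ℕ, U ⊆ Finset.range n → bushLine d m U x =
      ∑ j ∈ Finset.range n, (if j ∈ U then (1 : ℝ) else 0) *
        ((1 / 2 : ℝ) ^ (j + 1) * (x - d * pivot m j)) := by
    intro U hU
    simp only [ite_mul, one_mul, zero_mul, bushLine]
    rw [← Finset.sum_filter, Finset.filter_mem_eq_inter, Finset.inter_eq_right.mpr hU]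
  rw [hsum S hS, hsum S' hS', ← Finset.sum_sub_distrib]
  simp only [← sub_mul]
  refine le_abs_sum_half_pow n _ (fun j => (if j ∈ S then (1 : ℝ) else 0) - if j ∈ S' then 1 else 0)
    ω hω ?_ ?_ ?_ ?_
  · intro i j hij
    have := mul_le_mul_of_nonneg_left (pivot_mono m hij) hd
    simp only
    linarith
  · intro j
    have := mul_le_mul_of_nonneg_left (pivot_le_half m j) hd
    linarith
  · intro j
    by_cases h : j ∈ S <;> by_cases h' : j ∈ S' <;> simp [h, h']
  · by_contra! hcon
    refine hne (Finset.ext fun j => ?_)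
    by_cases hj : j < n
    · have := hcon j hj
      by_cases h : j ∈ S <;> by_cases h' : j ∈ S' <;> simp [h, h'] at this ⊢
    · exact ⟨fun h => absurd (Finset.mem_range.mp (hS h)) hj,
        fun h => absurd (Finset.mem_range.mp (hS' h)) hj⟩

/-- Near the `k`-th pivot a line is determined, up to a small error, by its first `k` digits. -/
theorem abs_bushLine_sub_filter_le {d x : ℝ} (hd : 0 ≤ d) {n m k : ℕ} (hm : 0 < m)
    (hx : |x - d * pivot m k| ≤ d / m) {S : Finset ℕ} (hS : S ⊆ Finset.range n) :
    |bushLine d m S x - bushLine d m (S.filter (· < k)) x| ≤ 2 * (1 / 2) ^ k * (d / m) := by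
  have hm' : (0 : ℝ) < m := by exact_mod_cast hm
  have hsplit : bushLine d m S x - bushLine d m (S.filter (· < k)) x =
      bushLine d m (S.filter (¬ · < k)) x := by
    unfold bushLine
    rw [← Finset.sum_filter_add_sum_filter_not S (· < k)]
    ring
  have hsub : S.filter (¬ · < k) ⊆ (Finset.range n).map (addLeftEmbedding k) := by
    intro j hj
    simp only [Finset.mem_filter, not_lt] at hj
    have := Finset.mem_range.mp (hS hj.1)
    simp only [Finset.mem_map, Finset.mem_range, addLeftEmbedding_apply]
    exact ⟨j - k, by omega, by omega⟩
  rw [hsplit]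
  calc |bushLine d m (S.filter (¬ · < k)) x|
      ≤ ∑ j ∈ S.filter (¬ · < k), |(1 / 2 : ℝ) ^ (j + 1) * (x - d * pivot m j)| :=
        Finset.abs_sum_le_sum_abs _ _
    _ ≤ ∑ j ∈ (Finset.range n).map (addLeftEmbedding k),
          |(1 / 2 : ℝ) ^ (j + 1) * (x - d * pivot m j)| :=
        Finset.sum_le_sum_of_subset_of_nonneg hsub fun _ _ _ => abs_nonneg _
    _ = ∑ i ∈ Finset.range n, |(1 / 2 : ℝ) ^ (k + i + 1) * (x - d * pivot m (k + i))| := by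
        simp
    _ ≤ ∑ i ∈ Finset.range n, (1 / 2) ^ k * (d / m) * ((1 / 2 : ℝ) ^ (i + 1) * (1 + i)) := by
        refine Finset.sum_le_sum fun i _ => ?_
        rw [abs_mul, abs_of_nonneg (by positivity : (0 : ℝ) ≤ (1 / 2) ^ (k + i + 1))]
        have hdist : |x - d * pivot m (k + i)| ≤ d / m * (1 + i) := by
          have h1 := mul_le_mul_of_nonneg_left (pivot_sub_le hm k i) hd
          have h2 := mul_le_mul_of_nonneg_left (pivot_mono m (Nat.le_add_right k i)) hd
          have h3 : d * ((i : ℝ) / m) = d / m * i := by ring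
          rw [abs_le] at hx ⊢
          have h4 : 0 ≤ d / m * (i : ℝ) := by positivity
          constructor <;> nlinarith
        calc (1 / 2 : ℝ) ^ (k + i + 1) * |x - d * pivot m (k + i)|
            ≤ (1 / 2 : ℝ) ^ (k + i + 1) * (d / m * (1 + i)) := by gcongr
          _ = _ := by rw [pow_add, pow_add, pow_add]; ring
    _ = (1 / 2) ^ k * (d / m) * ∑ i ∈ Finset.range n, ((1 / 2 : ℝ) ^ (i + 1) * (1 + i)) := by
        rw [Finset.mul_sum]
    _ ≤ (1 / 2) ^ k * (d / m) * 2 := by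
        gcongr
        exact sum_succ_mul_half_pow_le n
    _ = 2 * (1 / 2) ^ k * (d / m) := by ring

theorem exists_pivot_near {d x : ℝ} (hd : 0 < d) {m : ℕ} (hm : 0 < m)
    (hx : -(d / m) ≤ x) (hx' : x ≤ d / 2 + d / m) :
    ∃ k ≤ m, |x - d * pivot m k| ≤ d / m := by
  have hm' : (0 : ℝ) < m := by exact_mod_cast hm
  have hdm : 0 < d / m := by positivity
  have hpiv : ∀ k ≤ m, d * pivot m k = k * (d / m) / 2 := by
    intro k hk
    rw [pivot, min_eq_left hk]
    field_simp
  have htot : (m : ℝ) * (d / m) = d := by field_simp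
  rcases le_or_gt x 0 with h0 | h0
  · refine ⟨0, Nat.zero_le _, ?_⟩
    rw [hpiv 0 (Nat.zero_le _), abs_le]
    constructor <;> push_cast <;> linarith
  rcases le_or_gt (d / 2) x with h1 | h1
  · refine ⟨m, le_rfl, ?_⟩
    rw [hpiv m le_rfl, abs_le, htot]
    constructor <;> linarith
  · have hfl := Nat.floor_le (by positivity : 0 ≤ 2 * x / (d / m))
    have hfl' := Nat.lt_floor_add_one (2 * x / (d / m))
    rw [le_div_iff₀ hdm] at hfl
    rw [div_lt_iff₀ hdm] at hfl'
    have hk : ⌊2 * x / (d / m)⌋₊ ≤ m := by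
      have : (⌊2 * x / (d / m)⌋₊ : ℝ) * (d / m) ≤ m * (d / m) := by linarith
      exact_mod_cast le_of_mul_le_mul_right this hdm
    refine ⟨_, hk, ?_⟩
    rw [hpiv _ hk, abs_le]
    constructor <;> nlinarith

/-! ### Measure and rigid motions in coordinates -/

theorem volume_le_of_slices {F : Set Plane} (hF : MeasurableSet F) {A B : ℝ} {L : ℝ≥0∞}
    (hx : ∀ q ∈ F, q 0 ∈ Set.Icc A B)
    (hs : ∀ x ∈ Set.Icc A B, volume {y : ℝ | !₂[x, y] ∈ F} ≤ L) :
    volume F ≤ L * ENNReal.ofReal (B - A) := by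
  have hmp : MeasurePreserving (fun z : ℝ × ℝ => (!₂[z.1, z.2] : Plane)) :=
    (PiLp.volume_preserving_toLp (Fin 2)).comp (volume_preserving_finTwoArrow ℝ).symm
  rw [← hmp.measure_preimage hF.nullMeasurableSet, Measure.volume_eq_prod,
    Measure.prod_apply (hmp.measurable hF)]
  calc ∫⁻ x, volume (Prod.mk x ⁻¹' ((fun z : ℝ × ℝ => (!₂[z.1, z.2] : Plane)) ⁻¹' F))
      ≤ ∫⁻ x, (Set.Icc A B).indicator (fun _ => L) x := by
        refine lintegral_mono fun x => ?_
        by_cases h : x ∈ Set.Icc A B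
        · rw [Set.indicator_of_mem h]
          exact hs x h
        · rw [Set.indicator_of_notMem h]
          refine le_of_eq (measure_mono_null (t := ∅) (fun y hy => h ?_) measure_empty)
          simpa using hx _ hy
    _ = L * ENNReal.ofReal (B - A) := by
        rw [lintegral_indicator_const measurableSet_Icc, Real.volume_Icc]

/-- Rotation of the plane with cosine `c` and sine `s`. -/
noncomputable def planeRotation (c s : ℝ) (h : c ^ 2 + s ^ 2 = 1) : Plane ≃ₗᵢ[ℝ] Plane where
  toFun q := !₂[c * q 0 - s * q 1, s * q 0 + c * q 1]
  invFun q := !₂[c * q 0 + s * q 1, -s * q 0 + c * q 1]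
  map_add' p q := by ext i; fin_cases i <;> simp <;> ring
  map_smul' k q := by ext i; fin_cases i <;> simp <;> ring
  left_inv q := by
    ext i
    fin_cases i <;> simp
    · linear_combination q 0 * h
    · linear_combination q 1 * h
  right_inv q := by
    ext i
    fin_cases i <;> simp
    · linear_combination q 0 * h
    · linear_combination q 1 * h
  norm_map' q := by
    simp only [EuclideanSpace.norm_eq, Fin.sum_univ_two, Real.norm_eq_abs, sq_abs]
    congr 1
    simp
    linear_combination (q 0 ^ 2 + q 1 ^ 2) * h

theorem planeRotation_apply (c s : ℝ) (h : c ^ 2 + s ^ 2 = 1) (q : Plane) :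
    planeRotation c s h q = !₂[c * q 0 - s * q 1, s * q 0 + c * q 1] := rfl

theorem inv_sqrt_sq_add (a : ℝ) :
    (√(1 + a ^ 2))⁻¹ ^ 2 + (a * (√(1 + a ^ 2))⁻¹) ^ 2 = 1 := by
  have h : √(1 + a ^ 2) ^ 2 = 1 + a ^ 2 := Real.sq_sqrt (by positivity)
  have h' : 0 < √(1 + a ^ 2) := Real.sqrt_pos.mpr (by positivity)
  field_simp
  exact h.symm

/-- The rigid motion taking the horizontal axis to the line `y = a x + b`, in coordinates
centred at `x₀`. -/
noncomputable def placeOnLine (x₀ : Plane) (a b : ℝ) : Plane ≃ᵢ Plane :=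
  (planeRotation _ _ (inv_sqrt_sq_add a)).toIsometryEquiv.trans
    (IsometryEquiv.addLeft (x₀ + !₂[0, b]))

theorem placeOnLine_apply_zero (x₀ : Plane) (a b : ℝ) (q : Plane) :
    placeOnLine x₀ a b q 0 = x₀ 0 + (√(1 + a ^ 2))⁻¹ * (q 0 - a * q 1) := by
  simp [placeOnLine, planeRotation_apply]
  ring

theorem placeOnLine_apply_one (x₀ : Plane) (a b : ℝ) (q : Plane) :
    placeOnLine x₀ a b q 1 = x₀ 1 + b + (√(1 + a ^ 2))⁻¹ * (a * q 0 + q 1) := by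
  simp [placeOnLine, planeRotation_apply]
  ring

theorem placeOnLine_height (x₀ : Plane) (a b : ℝ) (q : Plane) :
    placeOnLine x₀ a b q 1 - x₀ 1 - (a * (placeOnLine x₀ a b q 0 - x₀ 0) + b) =
      √(1 + a ^ 2) * q 1 := by
  rw [placeOnLine_apply_zero, placeOnLine_apply_one]
  have h : √(1 + a ^ 2) ^ 2 = 1 + a ^ 2 := Real.sq_sqrt (by positivity)
  have h' : 0 < √(1 + a ^ 2) := Real.sqrt_pos.mpr (by positivity)
  field_simp
  linear_combination (-q 1) * h

theorem volume_placeOnLine_image (x₀ : Plane) (a b : ℝ) (A : Set Plane) :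
    volume (placeOnLine x₀ a b '' A) = volume A := by
  have : placeOnLine x₀ a b '' A =
      (fun q => (x₀ + !₂[0, b]) + q) '' (planeRotation _ _ (inv_sqrt_sq_add a) '' A) := by
    rw [Set.image_image]; rfl
  rw [this, Set.image_add_left, measure_preimage_add, ← LinearIsometryEquiv.coe_toMeasurableEquiv,
    MeasurableEquiv.image_eq_preimage_symm]
  exact (LinearIsometryEquiv.measurePreserving
    (planeRotation _ _ (inv_sqrt_sq_add a)).symm).measure_preimage_equiv
      (f := (planeRotation _ _ (inv_sqrt_sq_add a)).symm.toMeasurableEquiv) A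

theorem sqrt_one_add_sq_bounds {a : ℝ} (h0 : 0 ≤ a) (h1 : a ≤ 1) :
    √(1 + a ^ 2) ≤ 2 ∧ 7 / 10 ≤ (√(1 + a ^ 2))⁻¹ ∧ (√(1 + a ^ 2))⁻¹ ≤ 1 := by
  have h' : 0 < √(1 + a ^ 2) := Real.sqrt_pos.mpr (by positivity)
  have hu : √(1 + a ^ 2) ≤ 10 / 7 := by
    rw [Real.sqrt_le_left (by norm_num)]
    nlinarith
  refine ⟨by linarith, ?_, inv_le_one_of_one_le₀ ?_⟩
  · rw [le_inv_comm₀ (by norm_num) h']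
    linarith
  · rw [Real.one_le_sqrt]
    nlinarith

/-- A level set criterion for the maximal operator applied to an indicator function. -/
theorem quarter_le_maximalFn {X : Type*} [MeasurableSpace X] {μ : Measure X} {ℬ : Set (Set X)}
    {F T A : Set X} (hF : MeasurableSet F) (hT : T ∈ ℬ) (h0 : μ T ≠ 0) (htop : μ T ≠ ∞)
    (hAF : A ⊆ F) (hAT : A ⊆ T) (hA : 1 / 4 * μ T ≤ μ A) {x : X} (hx : x ∈ T) :
    1 / 4 ≤ maximalFn μ ℬ (F.indicator fun _ => (1 : ℝ)) x := by
  have hint : ∫⁻ y in T, ‖F.indicator (fun _ => (1 : ℝ)) y‖₊ ∂μ = μ (F ∩ T) := by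
    have : (fun y => (‖F.indicator (fun _ => (1 : ℝ)) y‖₊ : ℝ≥0∞)) =
        F.indicator fun _ => 1 := by
      ext y
      by_cases hy : y ∈ F <;> simp [hy]
    rw [this, lintegral_indicator_const hF, one_mul, Measure.restrict_apply hF]
  calc (1 / 4 : ℝ≥0∞) = (μ T)⁻¹ * (1 / 4 * μ T) := by
        rw [mul_comm (1 / 4), ← mul_assoc, ENNReal.inv_mul_cancel h0 htop, one_mul]
    _ ≤ (μ T)⁻¹ * ∫⁻ y in T, ‖F.indicator (fun _ => (1 : ℝ)) y‖₊ ∂μ := by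
        rw [hint]
        gcongr
        exact hA.trans (measure_mono (Set.subset_inter hAF hAT))
    _ ≤ _ := le_iSup₂_of_le T hT (le_iSup_of_le (f := fun _ : x ∈ T => _) hx le_rfl)

/-! ### Bushes of congruent convex sets -/

/-- The rigid motion placing the horizontal axis on the line of the bush coded by `S`. -/
noncomputable def bushMap (x₀ : Plane) (d : ℝ) (m : ℕ) (S : Finset ℕ) : Plane ≃ᵢ Plane :=
  placeOnLine x₀ (bushSlope S) (bushLine d m S 0)

theorem abs_bushMap_height_le (x₀ : Plane) (d : ℝ) (m : ℕ) {n : ℕ} {S : Finset ℕ}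
    (hS : S ⊆ Finset.range n) (q : Plane) :
    |bushMap x₀ d m S q 1 - x₀ 1 - bushLine d m S (bushMap x₀ d m S q 0 - x₀ 0)| ≤
      2 * |q 1| := by
  rw [bushLine_eq, bushMap, placeOnLine_height, abs_mul, abs_of_nonneg (Real.sqrt_nonneg _)]
  gcongr
  exact (sqrt_one_add_sq_bounds (bushSlope_nonneg S) (bushSlope_le_one hS)).1

theorem bushMap_abscissa_bounds (x₀ : Plane) {d η l u : ℝ} (m : ℕ) {n : ℕ} {S : Finset ℕ}
    (hS : S ⊆ Finset.range n) {q : Plane} (hl : 0 ≤ l) (hlq : l ≤ q 0) (hqu : q 0 ≤ u)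
    (hη : |q 1| ≤ η) :
    7 / 10 * l - η ≤ bushMap x₀ d m S q 0 - x₀ 0 ∧ bushMap x₀ d m S q 0 - x₀ 0 ≤ u + η := by
  obtain ⟨-, hc, hc'⟩ := sqrt_one_add_sq_bounds (bushSlope_nonneg S) (bushSlope_le_one hS)
  rw [bushMap, placeOnLine_apply_zero, add_sub_cancel_left]
  set c := (√(1 + bushSlope S ^ 2))⁻¹
  have hcs : |c * (bushSlope S * q 1)| ≤ η := by
    rw [abs_mul, abs_mul, abs_of_nonneg (by linarith : 0 ≤ c), abs_of_nonneg (bushSlope_nonneg S)]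
    have h1 : bushSlope S * |q 1| ≤ 1 * η :=
      mul_le_mul (bushSlope_le_one hS) hη (abs_nonneg _) zero_le_one
    have h2 : c * (bushSlope S * |q 1|) ≤ 1 * (1 * η) :=
      mul_le_mul hc' h1 (mul_nonneg (bushSlope_nonneg S) (abs_nonneg _)) zero_le_one
    linarith
  rw [abs_le] at hcs
  have h1 : 7 / 10 * l ≤ c * q 0 := mul_le_mul hc hlq hl (by linarith)
  have h2 : c * q 0 ≤ 1 * u := mul_le_mul hc' hqu (hl.trans hlq) zero_le_one
  constructor <;> nlinarith

theorem volume_bushMap_image (x₀ : Plane) (d : ℝ) (m : ℕ) (S : Finset ℕ) (A : Set Plane) :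
    volume (bushMap x₀ d m S '' A) = volume A := volume_placeOnLine_image _ _ _ _

theorem half_pow_two_mul (m : ℕ) : (1 / 2 : ℝ) ^ (2 * m) = (1 / 4) ^ m := by
  rw [pow_mul]; norm_num

theorem natCast_mul_quarter_pow_le (m : ℕ) : (m : ℝ) * (1 / 4) ^ m ≤ 1 := by
  have h : (m : ℝ) ≤ 4 ^ m := by
    exact_mod_cast (Nat.lt_pow_self (by norm_num : 1 < 4)).le
  rw [one_div, inv_pow, ← div_eq_mul_inv]
  exact div_le_one_of_le₀ h (by positivity)

theorem natCast_mul_half_pow_le (m : ℕ) : (m : ℝ) * (1 / 2) ^ m ≤ 1 := by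
  have h : (m : ℝ) ≤ 2 ^ m := by
    exact_mod_cast (Nat.lt_pow_self (by norm_num : 1 < 2)).le
  rw [one_div, inv_pow, ← div_eq_mul_inv]
  exact div_le_one_of_le₀ h (by positivity)

/-- The vertical slices of the left half of a bush are small. -/
theorem volume_slice_le {d η x : ℝ} (hd : 0 < d) (hη : 0 ≤ η) {m : ℕ} (hm : 0 < m)
    (hηd : 160 * η ≤ d * (1 / 4) ^ m) (hx : -(d / m) ≤ x) (hx' : x ≤ d / 2 + d / m) :
    volume {y : ℝ | ∃ S ⊆ Finset.range (2 * m), |y - bushLine d m S x| ≤ 2 * η} ≤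
      ENNReal.ofReal (5 * (d / m)) := by
  have hm' : (0 : ℝ) < m := by exact_mod_cast hm
  obtain ⟨k, hkm, hk⟩ := exists_pivot_near hd hm hx hx'
  set ρ := 2 * (1 / 2) ^ k * (d / m) + 2 * η
  have hsub : {y : ℝ | ∃ S ⊆ Finset.range (2 * m), |y - bushLine d m S x| ≤ 2 * η} ⊆
      ⋃ P ∈ (Finset.range k).powerset, closedBall (bushLine d m P x) ρ := by
    rintro y ⟨S, hS, hy⟩
    simp only [Set.mem_iUnion]
    refine ⟨S.filter (· < k), Finset.mem_powerset.mpr fun j hj => ?_, ?_⟩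
    · simpa using (Finset.mem_filter.mp hj).2
    · rw [mem_closedBall, Real.dist_eq]
      have h1 := abs_bushLine_sub_filter_le hd.le hm hk hS
      have h2 := abs_sub_le y (bushLine d m S x) (bushLine d m (S.filter (· < k)) x)
      simp only [ρ]
      linarith
  have hpow : (2 : ℝ) ^ k * (1 / 2) ^ k = 1 := by rw [← mul_pow]; norm_num
  have hηk : (2 : ℝ) ^ k * (160 * η) ≤ d / m := by
    have h2k : (2 : ℝ) ^ k ≤ 2 ^ m := pow_le_pow_right₀ (by norm_num) hkm
    have h3 : (2 : ℝ) ^ m * (1 / 4) ^ m = (1 / 2) ^ m := by rw [← mul_pow]; norm_num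
    calc (2 : ℝ) ^ k * (160 * η) ≤ 2 ^ m * (d * (1 / 4) ^ m) := by gcongr
      _ = d * (1 / 2) ^ m := by rw [← h3]; ring
      _ ≤ d / m := by
        rw [le_div_iff₀ hm', mul_assoc, mul_comm _ (m : ℝ)]
        exact mul_le_of_le_one_right hd.le (natCast_mul_half_pow_le m)
  calc volume {y : ℝ | ∃ S ⊆ Finset.range (2 * m), |y - bushLine d m S x| ≤ 2 * η}
      ≤ ∑ P ∈ (Finset.range k).powerset, volume (closedBall (bushLine d m P x) ρ) :=
        (measure_mono hsub).trans (measure_biUnion_finset_le _ _)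
    _ = ENNReal.ofReal (2 ^ k * (2 * ρ)) := by
        simp only [Real.volume_closedBall, Finset.sum_const, Finset.card_powerset,
          Finset.card_range, nsmul_eq_mul]
        rw [ENNReal.ofReal_mul (p := 2 ^ k) (by positivity), ENNReal.ofReal_pow (by norm_num)]
        simp
    _ ≤ ENNReal.ofReal (5 * (d / m)) := by
        refine ENNReal.ofReal_le_ofReal ?_
        have : (2 : ℝ) ^ k * (2 * ρ) = 4 * (2 ^ k * (1 / 2) ^ k) * (d / m) + 4 * (2 ^ k * η) := by
          simp only [ρ]; ring
        rw [this, hpow]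
        have : 0 ≤ 2 ^ k * η := by positivity
        linarith

theorem volume_bush_left_le (x₀ : Plane) {d η : ℝ} (hd : 0 < d) (hη : 0 ≤ η) {m : ℕ} (hm : 0 < m)
    (hηd : 160 * η ≤ d * (1 / 4) ^ m) {A : Set Plane}
    (hF : MeasurableSet (⋃ S ∈ (Finset.range (2 * m)).powerset, bushMap x₀ d m S '' A))
    (hA : ∀ q ∈ A, 0 ≤ q 0 ∧ q 0 ≤ d / 2 ∧ |q 1| ≤ η) :
    volume (⋃ S ∈ (Finset.range (2 * m)).powerset, bushMap x₀ d m S '' A) ≤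
      ENNReal.ofReal (15 * d ^ 2 / m) := by
  have hm' : (0 : ℝ) < m := by exact_mod_cast hm
  have hm1 : (1 : ℝ) ≤ m := by exact_mod_cast hm
  have hηm : η ≤ d / m := by
    rw [le_div_iff₀ hm']
    have h1 := mul_le_mul_of_nonneg_left (natCast_mul_quarter_pow_le m) hd.le
    have h2 := mul_le_mul_of_nonneg_left hηd hm'.le
    have h3 : 0 ≤ η * m := by positivity
    linarith
  have key := volume_le_of_slices hF (A := x₀ 0 - d / m) (B := x₀ 0 + (d / 2 + d / m))
    (L := ENNReal.ofReal (5 * (d / m))) ?_ ?_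
  · refine key.trans ?_
    rw [← ENNReal.ofReal_mul (by positivity)]
    refine ENNReal.ofReal_le_ofReal ?_
    have h1 : d / m ≤ d := div_le_self hd.le hm1
    calc 5 * (d / m) * (x₀ 0 + (d / 2 + d / m) - (x₀ 0 - d / m))
        ≤ 5 * (d / m) * (3 * d) := by
          gcongr
          linarith
      _ = 15 * d ^ 2 / m := by ring
  · intro p hp
    simp only [Set.mem_iUnion] at hp
    obtain ⟨S, hS, q, hq, rfl⟩ := hp
    obtain ⟨h0, h1, h2⟩ := hA q hq
    have := bushMap_abscissa_bounds x₀ (d := d) m (Finset.mem_powerset.mp hS) le_rfl h0 h1 h2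
    constructor <;> linarith [this.1, this.2]
  · intro x hx
    have hsub : {y : ℝ | !₂[x, y] ∈ ⋃ S ∈ (Finset.range (2 * m)).powerset,
        bushMap x₀ d m S '' A} ⊆ (fun y => y + -x₀ 1) ⁻¹' {y : ℝ | ∃ S ⊆ Finset.range (2 * m),
          |y - bushLine d m S (x - x₀ 0)| ≤ 2 * η} := by
      intro y hy
      simp only [Set.mem_ofPred_eq, Set.mem_iUnion] at hy
      obtain ⟨S, hS, q, hq, hqy⟩ := hy
      refine ⟨S, Finset.mem_powerset.mp hS, ?_⟩
      have := abs_bushMap_height_le x₀ d m (Finset.mem_powerset.mp hS) q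
      rw [hqy] at this
      refine le_trans (le_of_eq ?_) (this.trans (by linarith [(hA q hq).2.2]))
      simp [sub_eq_add_neg]
    refine (measure_mono hsub).trans ?_
    rw [measure_preimage_add_right]
    exact volume_slice_le hd hη hm hηd (by linarith [hx.1]) (by linarith [hx.2])

theorem disjoint_bush_right (x₀ : Plane) {d η : ℝ} (hd : 0 < d) {m : ℕ}
    (hηd : 160 * η ≤ d * (1 / 4) ^ m) {B : Set Plane}
    (hB : ∀ q ∈ B, 7 * d / 8 ≤ q 0 ∧ |q 1| ≤ η) {S S' : Finset ℕ}
    (hS : S ⊆ Finset.range (2 * m)) (hS' : S' ⊆ Finset.range (2 * m)) (hne : S ≠ S') :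
    Disjoint (bushMap x₀ d m S '' B) (bushMap x₀ d m S' '' B) := by
  rw [Set.disjoint_left]
  rintro _ ⟨q, hq, rfl⟩ ⟨q', hq', heq⟩
  obtain ⟨hq0, hq1⟩ := hB q hq
  obtain ⟨hq0', hq1'⟩ := hB q' hq'
  have hpow : (1 / 4 : ℝ) ^ m ≤ 1 := pow_le_one₀ (by norm_num) (by norm_num)
  have hpow' : (0 : ℝ) < (1 / 4) ^ m := by positivity
  have hη : η ≤ d / 160 := by nlinarith
  have hx := (bushMap_abscissa_bounds x₀ (d := d) m hS (by positivity) hq0 le_rfl hq1).1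
  have hh := abs_bushMap_height_le x₀ d m hS q
  have hh' := abs_bushMap_height_le x₀ d m hS' q'
  rw [heq] at hh'
  set p := bushMap x₀ d m S q
  have hsep := le_abs_bushLine_sub hd.le (by positivity : 0 ≤ d / 20)
    (by linarith : d / 2 + d / 20 ≤ p 0 - x₀ 0) (m := m) hS hS' hne
  rw [half_pow_two_mul] at hsep
  have : |bushLine d m S (p 0 - x₀ 0) - bushLine d m S' (p 0 - x₀ 0)| ≤ 4 * η := by
    rw [abs_le] at hh hh' ⊢
    constructor <;> linarith
  have := mul_pos hd hpow'
  linarith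

theorem bushMap_mem_ball (x₀ : Plane) {d r : ℝ} (hd : 0 < d) (hr : 10 * d < r) {m n : ℕ}
    {S : Finset ℕ} (hS : S ⊆ Finset.range n) {q : Plane} (h0 : 0 ≤ q 0) (h1 : q 0 ≤ d)
    (h2 : |q 1| ≤ d) : bushMap x₀ d m S q ∈ ball x₀ r := by
  have hb := abs_bushLine_zero_le hd.le (m := m) hS
  have hc : dist x₀ (bushMap x₀ d m S 0) ≤ d := by
    rw [dist_eq_norm, EuclideanSpace.norm_eq, Fin.sum_univ_two]
    refine Real.sqrt_le_iff.mpr ⟨hd.le, ?_⟩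
    simp only [PiLp.sub_apply, bushMap, placeOnLine_apply_zero, placeOnLine_apply_one,
      Real.norm_eq_abs, sq_abs]
    rw [abs_le] at hb
    simp
    nlinarith
  have hq : dist (0 : Plane) q ≤ 2 * d := by
    rw [dist_zero_left, EuclideanSpace.norm_eq, Fin.sum_univ_two]
    refine Real.sqrt_le_iff.mpr ⟨by positivity, ?_⟩
    rw [abs_le] at h2
    simp only [Real.norm_eq_abs, sq_abs]
    nlinarith
  rw [mem_ball, dist_comm]
  have := dist_triangle x₀ (bushMap x₀ d m S 0) (bushMap x₀ d m S q)
  rw [(bushMap x₀ d m S).isometry.dist_eq] at this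
  linarith

theorem volume_homothety_image (p : Plane) {t : ℝ} (A : Set Plane) :
    volume (AffineMap.homothety p t '' A) = ENNReal.ofReal (t ^ 2) * volume A := by
  rw [Measure.addHaar_image_homothety, finrank_euclideanSpace_fin, abs_of_nonneg (sq_nonneg t)]

/-- Thin convex bodies: a bush of congruent copies whose left halves overlap heavily while their
right ends are disjoint. -/
theorem exists_large_levelSet {C : ℝ} (hC : 1 ≤ C) : ∃ ε : ℝ, 0 < ε ∧
    ∀ (d η : ℝ) (K T : Set Plane), 0 < d → 0 < η → η < ε * d → Convex ℝ K → IsCompact K →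
      0 ∈ K → !₂[d, 0] ∈ K → (∀ q ∈ K, 0 ≤ q 0 ∧ q 0 ≤ d ∧ |q 1| ≤ η) →
      ENNReal.ofReal (d * η / 4) ≤ volume K → (∃ g : Plane ≃ᵢ Plane, g '' K = T) →
      ∀ (x₀ : Plane) (r : ℝ), 10 * d < r →
        ∃ F : Set Plane, F ⊆ ball x₀ r ∧ MeasurableSet F ∧ 0 < volume F ∧
          ENNReal.ofReal C * volume F ≤ volume {x | (1 / 4 : ℝ≥0∞) ≤
            maximalFn volume (localFamily T x₀ r) (F.indicator fun _ => (1 : ℝ)) x} := by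
  obtain ⟨N, hN⟩ := exists_nat_gt (C * 15 * 163840)
  refine ⟨(1 / 4) ^ N / 160, by positivity, ?_⟩
  rintro d η K T hd hη hηε hKc hKK h0K hdK hK hvol ⟨g, hg⟩ x₀ r hr
  have hpowN : (1 / 4 : ℝ) ^ N ≤ 1 := pow_le_one₀ (by norm_num) (by norm_num)
  have hratio : 160 * η / d ≤ (1 / 4) ^ N := by
    rw [div_le_iff₀ hd]
    linarith
  obtain ⟨m, hm1, hm2⟩ := exists_nat_pow_near_of_lt_one (by positivity : 0 < 160 * η / d)
    (hratio.trans hpowN) (by norm_num : (0 : ℝ) < 1 / 4) (by norm_num)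
  have hNm : N ≤ m := by
    by_contra! hlt
    have : (1 / 4 : ℝ) ^ N ≤ (1 / 4) ^ (m + 1) :=
      pow_le_pow_of_le_one (by norm_num) (by norm_num) hlt
    linarith
  have hNm' : (N : ℝ) ≤ m := by exact_mod_cast hNm
  have hm' : (0 : ℝ) < m := by linarith
  have hm : 0 < m := by exact_mod_cast hm'
  rw [div_le_iff₀ hd, mul_comm _ d] at hm2
  rw [lt_div_iff₀ hd] at hm1
  have hηd : η ≤ d := by nlinarith
  set I := (Finset.range (2 * m)).powerset
  set A := AffineMap.homothety (0 : Plane) (1 / 2 : ℝ) '' K with hA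
  set B := AffineMap.homothety (!₂[d, 0] : Plane) (1 / 8 : ℝ) '' K with hB
  have hAK : A ⊆ K := by
    rintro _ ⟨q, hq, rfl⟩
    exact hKc.lineMap_mem h0K hq (by norm_num : (1 / 2 : ℝ) ∈ Set.Icc 0 1)
  have hBK : B ⊆ K := by
    rintro _ ⟨q, hq, rfl⟩
    exact hKc.lineMap_mem hdK hq (by norm_num : (1 / 8 : ℝ) ∈ Set.Icc 0 1)
  have hAcoord : ∀ q ∈ A, 0 ≤ q 0 ∧ q 0 ≤ d / 2 ∧ |q 1| ≤ η := by
    intro q hq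
    refine ⟨(hK q (hAK hq)).1, ?_, (hK q (hAK hq)).2.2⟩
    obtain ⟨p, hp, rfl⟩ := hq
    simp [AffineMap.homothety_apply]
    linarith [(hK p hp).2.1]
  have hBcoord : ∀ q ∈ B, 7 * d / 8 ≤ q 0 ∧ |q 1| ≤ η := by
    intro q hq
    refine ⟨?_, (hK q (hBK hq)).2.2⟩
    obtain ⟨p, hp, rfl⟩ := hq
    simp [AffineMap.homothety_apply]
    linarith [(hK p hp).1]
  have hAcomp : IsCompact A := hKK.image (AffineMap.homothety_continuous _ _)
  have hBcomp : IsCompact B := hKK.image (AffineMap.homothety_continuous _ _)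
  have hK0 : volume K ≠ 0 := by
    refine (lt_of_lt_of_le ?_ hvol).ne'
    rw [ENNReal.ofReal_pos]
    positivity
  set F := ⋃ S ∈ I, bushMap x₀ d m S '' A
  have hFmeas : MeasurableSet F := Finset.measurableSet_biUnion _ fun S _ =>
    (hAcomp.image (bushMap x₀ d m S).continuous).isClosed.measurableSet
  have hball : ∀ S ∈ I, bushMap x₀ d m S '' K ⊆ ball x₀ r := by
    rintro S hS _ ⟨q, hq, rfl⟩
    obtain ⟨h0, h1, h2⟩ := hK q hq
    exact bushMap_mem_ball x₀ hd hr (Finset.mem_powerset.mp hS) h0 h1 (h2.trans hηd)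
  have hvolA : volume A = ENNReal.ofReal (1 / 4) * volume K := by
    rw [hA, volume_homothety_image]
    norm_num
  have hvolB : volume B = ENNReal.ofReal (1 / 64) * volume K := by
    rw [hB, volume_homothety_image]
    norm_num
  have hlevel : (⋃ S ∈ I, bushMap x₀ d m S '' B) ⊆ {x | (1 / 4 : ℝ≥0∞) ≤
      maximalFn volume (localFamily T x₀ r) (F.indicator fun _ => (1 : ℝ)) x} := by
    intro x hx
    simp only [Set.mem_iUnion] at hx
    obtain ⟨S, hS, hxS⟩ := hx
    have hmem : bushMap x₀ d m S '' K ∈ localFamily T x₀ r := by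
      refine ⟨⟨g.symm.trans (bushMap x₀ d m S), ?_⟩, hball S hS⟩
      rw [← hg, Set.image_image]
      simp
    refine quarter_le_maximalFn (A := bushMap x₀ d m S '' A) hFmeas hmem ?_ ?_
      (Set.subset_biUnion_of_mem (u := fun S => bushMap x₀ d m S '' A) hS)
      (Set.image_mono hAK) ?_ (Set.image_mono hBK hxS)
    · rwa [volume_bushMap_image]
    · rw [volume_bushMap_image]
      exact hKK.measure_lt_top.ne
    · rw [volume_bushMap_image, volume_bushMap_image, hvolA, ENNReal.ofReal_div_of_pos (by norm_num)]
      simp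
  refine ⟨F, ?_, hFmeas, ?_, ?_⟩
  · exact Set.iUnion₂_subset fun S hS => (Set.image_mono hAK).trans (hball S hS)
  · refine lt_of_lt_of_le ?_ (measure_mono (Set.subset_biUnion_of_mem
      (u := fun S => bushMap x₀ d m S '' A) (Finset.empty_mem_powerset (Finset.range (2 * m)))))
    rw [volume_bushMap_image, hvolA]
    exact ENNReal.mul_pos (by simp) hK0
  · refine le_trans ?_ (measure_mono hlevel)
    rw [measure_biUnion_finset (fun S hS S' hS' hne => disjoint_bush_right x₀ hd hm2 hBcoord
      (Finset.mem_powerset.mp hS) (Finset.mem_powerset.mp hS') hne) fun S _ =>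
      (hBcomp.image (bushMap x₀ d m S).continuous).isClosed.measurableSet]
    simp only [volume_bushMap_image, hvolB, Finset.sum_const, Finset.card_powerset,
      Finset.card_range, nsmul_eq_mul]
    calc ENNReal.ofReal C * volume F
        ≤ ENNReal.ofReal C * ENNReal.ofReal (15 * d ^ 2 / m) := by
          gcongr
          exact volume_bush_left_le x₀ hd hη.le hm hm2 hFmeas hAcoord
      _ = ENNReal.ofReal (C * (15 * d ^ 2 / m)) := (ENNReal.ofReal_mul (by linarith)).symm
      _ ≤ ENNReal.ofReal (2 ^ (2 * m) * (1 / 64 * (d * η / 4))) := by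
          refine ENNReal.ofReal_le_ofReal ?_
          have h1 : C * (15 * d ^ 2 / m) ≤ d ^ 2 / 163840 := by
            rw [← mul_div_assoc, div_le_div_iff₀ hm' (by norm_num)]
            nlinarith [sq_nonneg d]
          have h2 : (2 : ℝ) ^ (2 * m) * (1 / 4) ^ m = 1 := by
            rw [pow_mul, ← mul_pow]; norm_num
          have h3 : d * (2 ^ (2 * m) * ((1 / 4) ^ (m + 1) * d)) ≤ d * (2 ^ (2 * m) * (160 * η)) := by
            gcongr
          have h4 : d * (2 ^ (2 * m) * ((1 / 4) ^ (m + 1) * d)) = d ^ 2 / 4 := by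
            rw [pow_succ]
            linear_combination d ^ 2 / 4 * h2
          linarith
      _ ≤ _ := by
          rw [ENNReal.ofReal_mul (by positivity), ENNReal.ofReal_mul (by positivity),
            ENNReal.ofReal_pow (by norm_num)]
          gcongr
          simp

/-! ### Triangles in normal position -/

/-- The triangle with base `[0, d]` on the horizontal axis and apex `(s, h)`. -/
def normalTriangle (d s h : ℝ) : Set Plane := convexHull ℝ {0, !₂[d, 0], !₂[s, h]}

theorem normalTriangle_bounds {d s h : ℝ} (hs : 0 ≤ s) (hsd : s ≤ d) {q : Plane}
    (hq : q ∈ normalTriangle d s h) : 0 ≤ q 0 ∧ q 0 ≤ d ∧ |q 1| ≤ |h| := by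
  have hconv : Convex ℝ {q : Plane | 0 ≤ q 0 ∧ q 0 ≤ d ∧ |q 1| ≤ |h|} := by
    intro p hp q hq t u ht hu htu
    obtain ⟨hp0, hp1, hp2⟩ := hp
    obtain ⟨hq0, hq1, hq2⟩ := hq
    simp only [Set.mem_ofPred_eq, PiLp.add_apply, PiLp.smul_apply, smul_eq_mul]
    refine ⟨by positivity, ?_, ?_⟩
    · calc t * p 0 + u * q 0 ≤ t * d + u * d := by gcongr
        _ = d := by rw [← add_mul, htu, one_mul]
    · calc |t * p 1 + u * q 1| ≤ t * |p 1| + u * |q 1| := by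
            refine (abs_add_le _ _).trans_eq ?_
            rw [abs_mul, abs_mul, abs_of_nonneg ht, abs_of_nonneg hu]
        _ ≤ t * |h| + u * |h| := by gcongr
        _ = |h| := by rw [← add_mul, htu, one_mul]
  refine convexHull_min ?_ hconv hq
  rintro _ (rfl | rfl | rfl)
  · simpa using hs.trans hsd
  · simpa using hs.trans hsd
  · simpa using ⟨hs, hsd⟩

theorem le_volume_normalTriangle (d s h : ℝ) :
    ENNReal.ofReal (|d * h| / 4) ≤ volume (normalTriangle d s h) := by
  have hmp : MeasurePreserving (fun z : ℝ × ℝ => (!₂[z.1, z.2] : Plane)) :=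
    (PiLp.volume_preserving_toLp (Fin 2)).comp (volume_preserving_finTwoArrow ℝ).symm
  let A : Matrix (Fin 2) (Fin 2) ℝ := !![d, s; 0, h]
  let f : Plane →ₗ[ℝ] Plane := Matrix.toLpLin 2 2 A
  have hfapp : ∀ q : Plane, f q = !₂[d * q 0 + s * q 1, h * q 1] := by
    intro q
    ext i
    fin_cases i <;> simp [f, A, Matrix.toLpLin_apply, dotProduct, Fin.sum_univ_two]
  have hdet : LinearMap.det f = d * h := by
    simp [f, A, Matrix.det_fin_two]
  let Q : Set Plane := {q | (0 ≤ q 0 ∧ q 0 ≤ 1 / 2) ∧ 0 ≤ q 1 ∧ q 1 ≤ 1 / 2}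
  have hQm : MeasurableSet Q := by
    have hge : ∀ i, IsClosed {q : Plane | 0 ≤ q i} := fun i =>
      isClosed_le continuous_const (by fun_prop)
    have hle : ∀ i, IsClosed {q : Plane | q i ≤ 1 / 2} := fun i =>
      isClosed_le (by fun_prop) continuous_const
    exact (((hge 0).inter (hle 0)).inter ((hge 1).inter (hle 1))).measurableSet
  have hQ : volume Q = ENNReal.ofReal (1 / 4) := by
    rw [← hmp.measure_preimage hQm.nullMeasurableSet]
    have : (fun z : ℝ × ℝ => (!₂[z.1, z.2] : Plane)) ⁻¹' Q =
        Set.Icc 0 (1 / 2) ×ˢ Set.Icc 0 (1 / 2) := by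
      ext z
      simp only [Q, Set.mem_preimage, Set.mem_ofPred_eq, Set.mem_prod, Set.mem_Icc]
      rfl
    rw [this, Measure.volume_eq_prod, Measure.prod_prod, Real.volume_Icc,
      ← ENNReal.ofReal_mul (by norm_num)]
    norm_num
  have hsub : f '' Q ⊆ normalTriangle d s h := by
    rintro _ ⟨q, ⟨⟨h0, h1⟩, h2, h3⟩, rfl⟩
    have hc : Convex ℝ (normalTriangle d s h) := convex_convexHull ℝ _
    have hv : ∀ p ∈ ({0, !₂[d, 0], !₂[s, h]} : Set Plane), p ∈ normalTriangle d s h :=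
      fun p hp => subset_convexHull ℝ _ hp
    have := hc.sum_mem (t := Finset.univ) (w := ![1 - q 0 - q 1, q 0, q 1])
      (z := ![0, !₂[d, 0], !₂[s, h]]) (by
        intro i _
        fin_cases i <;> simp <;> linarith) (by simp [Fin.sum_univ_three]; ring) (by
        intro i _
        fin_cases i <;> exact hv _ (by simp))
    convert this using 1
    rw [hfapp]
    ext i
    fin_cases i <;> simp [Fin.sum_univ_three] <;> ring
  calc ENNReal.ofReal (|d * h| / 4) = ENNReal.ofReal |LinearMap.det f| * volume Q := by
        rw [hdet, hQ, ← ENNReal.ofReal_mul (abs_nonneg _)]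
        congr 1
        ring
    _ = volume (f '' Q) := (Measure.addHaar_image_linearMap _ _ _).symm
    _ ≤ _ := measure_mono hsub

/-- Twice the signed area spanned by two plane vectors. -/
def planeDet (v w : Plane) : ℝ := v 0 * w 1 - v 1 * w 0

theorem abs_planeDet_le_angle_mul (v w : Plane) :
    |planeDet v w| ≤ InnerProductGeometry.angle v w * (‖v‖ * ‖w‖) := by
  have h := InnerProductGeometry.sin_angle_mul_norm_mul_norm v w
  have hgram : inner ℝ v v * inner ℝ w w - inner ℝ v w * inner ℝ v w = planeDet v w ^ 2 := by
    simp only [planeDet, PiLp.inner_apply, Fin.sum_univ_two, RCLike.inner_apply, conj_trivial]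
    ring
  rw [hgram, Real.sqrt_sq_eq_abs] at h
  rw [← h]
  gcongr
  exact Real.sin_le (InnerProductGeometry.angle_nonneg v w)

theorem planeDet_ne_zero {a b c : Plane} (h : AffineIndependent ℝ ![a, b, c]) :
    planeDet (b - a) (c - a) ≠ 0 := by
  intro h0
  have hne : a ≠ b := fun hab => by
    simpa using h.injective (a₁ := 0) (a₂ := 1) (by simpa using hab)
  rw [affineIndependent_iff_not_collinear_set] at h
  refine h ?_
  rw [collinear_iff_of_mem (p₀ := a) (by simp)]
  simp only [planeDet, PiLp.sub_apply] at h0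
  refine ⟨b - a, ?_⟩
  have hpos : 0 < (b 0 - a 0) ^ 2 + (b 1 - a 1) ^ 2 := by
    by_contra hcon
    refine hne ?_
    ext i
    fin_cases i <;> simp <;> nlinarith [sq_nonneg (b 0 - a 0), sq_nonneg (b 1 - a 1)]
  rintro _ (rfl | rfl | rfl)
  · exact ⟨0, by simp⟩
  · exact ⟨1, by simp⟩
  · rename_i c
    refine ⟨((b 0 - a 0) * (c 0 - a 0) + (b 1 - a 1) * (c 1 - a 1)) /
      ((b 0 - a 0) ^ 2 + (b 1 - a 1) ^ 2), ?_⟩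
    ext i
    fin_cases i <;> simp <;> field_simp
    · linear_combination (-(b 1 - a 1)) * h0
    · linear_combination (b 0 - a 0) * h0

theorem exists_isometry_normalTriangle {a b c : Plane} (hab : 0 < ‖b - a‖) :
    ∃ g : Plane ≃ᵢ Plane, g '' normalTriangle ‖b - a‖ (inner ℝ (b - a) (c - a) / ‖b - a‖)
      (planeDet (b - a) (c - a) / ‖b - a‖) = convexHull ℝ {a, b, c} := by
  set d := ‖b - a‖ with hd
  have hd2 : d ^ 2 = (b 0 - a 0) ^ 2 + (b 1 - a 1) ^ 2 := by
    rw [hd, EuclideanSpace.norm_sq_eq, Fin.sum_univ_two]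
    simp
  have hcs : ((b 0 - a 0) / d) ^ 2 + ((b 1 - a 1) / d) ^ 2 = 1 := by
    field_simp
    exact hd2.symm
  let L := planeRotation _ _ hcs
  let φ : Plane →ᵃ[ℝ] Plane := L.toLinearEquiv.toLinearMap.toAffineMap + AffineMap.const ℝ Plane a
  have hφ : ∀ q, φ q = L q + a := fun q => rfl
  refine ⟨L.toIsometryEquiv.trans (IsometryEquiv.addRight a), ?_⟩
  change φ '' _ = _
  rw [normalTriangle, AffineMap.image_convexHull]
  simp only [Set.image_insert_eq, Set.image_singleton]
  have h1 : φ 0 = a := by simp [hφ]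
  have h2 : φ !₂[d, 0] = b := by
    rw [hφ, planeRotation_apply]
    ext i
    fin_cases i <;> simp <;> field_simp <;> ring
  have h3 : φ !₂[inner ℝ (b - a) (c - a) / d, planeDet (b - a) (c - a) / d] = c := by
    rw [hφ, planeRotation_apply]
    ext i
    fin_cases i <;> simp [planeDet, PiLp.inner_apply, Fin.sum_univ_two] <;> field_simp
    · linear_combination (-(c 0 - a 0)) * hd2
    · linear_combination (-(c 1 - a 1)) * hd2
  rw [h1, h2, h3]

theorem exists_normal_form_of_longest_side {ε : ℝ} (hε : 0 < ε) {a b c : Plane}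
    (hind : AffineIndependent ℝ ![a, b, c]) (hac : dist a c ≤ dist a b)
    (hbc : dist b c ≤ dist a b) (hangle : ∠ b a c * ∠ a b c * ∠ a c b < ε ^ 3) :
    ∃ d s h : ℝ, 0 < d ∧ 0 ≤ s ∧ s ≤ d ∧ h ≠ 0 ∧ |h| < ε * d ∧
      d ≤ Metric.diam (convexHull ℝ {a, b, c}) ∧
      ∃ g : Plane ≃ᵢ Plane, g '' normalTriangle d s h = convexHull ℝ {a, b, c} := by
  have hdet := planeDet_ne_zero hind
  have hne : a ≠ b := fun hab => hdet (by simp [planeDet, hab])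
  have hdist : dist a b = ‖b - a‖ := by rw [dist_comm, dist_eq_norm]
  have hd : 0 < ‖b - a‖ := by rw [← hdist]; exact dist_pos.mpr hne
  have hca : ‖c - a‖ ≤ ‖b - a‖ := by rwa [← hdist, ← dist_eq_norm, dist_comm c]
  have hcb : ‖c - b‖ ≤ ‖b - a‖ := by rwa [← hdist, ← dist_eq_norm, dist_comm c]
  set d := ‖b - a‖ with hddef
  set D := planeDet (b - a) (c - a) with hD
  refine ⟨d, inner ℝ (b - a) (c - a) / d, D / d, hd, ?_, ?_, div_ne_zero hdet hd.ne', ?_, ?_,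
    exists_isometry_normalTriangle hd⟩
  · have h1 : inner ℝ (b - a) (c - a) = d ^ 2 + inner ℝ (b - a) (c - b) := by
      rw [hddef, ← real_inner_self_eq_norm_sq, ← inner_add_right]
      congr 1
      abel
    have h2 := (abs_le.mp (abs_real_inner_le_norm (b - a) (c - b))).1
    have h3 : ‖b - a‖ * ‖c - b‖ ≤ d * d := by gcongr
    refine div_nonneg ?_ hd.le
    nlinarith
  · rw [div_le_iff₀ hd]
    exact (real_inner_le_norm _ _).trans (by gcongr)
  · rw [abs_div, abs_of_pos hd, div_lt_iff₀ hd]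
    by_contra! hcon
    have key : ∀ v w : Plane, ‖v‖ ≤ d → ‖w‖ ≤ d → |planeDet v w| = |D| →
        ε ≤ InnerProductGeometry.angle v w := by
      intro v w hv hw hvw
      have h1 := abs_planeDet_le_angle_mul v w
      have h2 : InnerProductGeometry.angle v w * (‖v‖ * ‖w‖) ≤
          InnerProductGeometry.angle v w * (d * d) :=
        mul_le_mul_of_nonneg_left (by gcongr) (InnerProductGeometry.angle_nonneg v w)
      rw [hvw] at h1
      refine le_of_mul_le_mul_right ?_ (mul_pos hd hd)
      linarith
    have hA : ε ≤ ∠ b a c := key _ _ le_rfl hca rfl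
    have hB : ε ≤ ∠ a b c := by
      refine key _ _ ?_ hcb ?_
      · rw [vsub_eq_sub, norm_sub_rev]
      · rw [← abs_neg, hD]
        congr 1
        simp only [planeDet, vsub_eq_sub, PiLp.sub_apply]
        ring
    have hC : ε ≤ ∠ a c b := by
      refine key _ _ ?_ ?_ ?_
      · rwa [vsub_eq_sub, norm_sub_rev]
      · rwa [vsub_eq_sub, norm_sub_rev]
      · rw [hD]
        congr 1
        simp only [planeDet, vsub_eq_sub, PiLp.sub_apply]
        ring
    have : ε * ε * ε ≤ ∠ b a c * ∠ a b c * ∠ a c b :=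
      mul_le_mul (mul_le_mul hA hB hε.le (angle_nonneg _ _ _)) hC hε.le
        (mul_nonneg (angle_nonneg _ _ _) (angle_nonneg _ _ _))
    nlinarith
  · rw [← hdist]
    refine dist_le_diam_of_mem ?_ (subset_convexHull ℝ _ (by simp))
      (subset_convexHull ℝ _ (by simp))
    exact ((Set.toFinite _).isCompact_convexHull ℝ).isBounded

theorem exists_normal_form {ε : ℝ} (hε : 0 < ε) {a b c : Plane}
    (hind : AffineIndependent ℝ ![a, b, c]) (hangle : ∠ b a c * ∠ a b c * ∠ a c b < ε ^ 3) :
    ∃ d s h : ℝ, 0 < d ∧ 0 ≤ s ∧ s ≤ d ∧ h ≠ 0 ∧ |h| < ε * d ∧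
      d ≤ Metric.diam (convexHull ℝ {a, b, c}) ∧
      ∃ g : Plane ≃ᵢ Plane, g '' normalTriangle d s h = convexHull ℝ {a, b, c} := by
  by_cases h1 : dist a c ≤ dist a b ∧ dist b c ≤ dist a b
  · exact exists_normal_form_of_longest_side hε hind h1.1 h1.2 hangle
  by_cases h2 : dist b c ≤ dist a c
  · have hset : ({a, b, c} : Set Plane) = {a, c, b} := by rw [Set.pair_comm b c]
    rw [hset]
    refine exists_normal_form_of_longest_side hε hind.comm_right ?_ ?_ ?_
    · by_contra! hcon
      exact h1 ⟨hcon.le, h2.trans hcon.le⟩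
    · rwa [dist_comm c b]
    · rw [angle_comm c a b]
      linarith
  · have hset : ({a, b, c} : Set Plane) = {b, c, a} := by
      rw [Set.insert_comm a b, Set.pair_comm a c]
    rw [hset]
    refine exists_normal_form_of_longest_side hε hind.comm_left.comm_right ?_ ?_ ?_
    · rw [dist_comm b a]
      by_contra! hcon
      exact h1 ⟨by linarith, hcon.le⟩
    · rw [dist_comm c a]
      linarith
    · rw [angle_comm c b a, angle_comm b c a, angle_comm b a c] at *
      linarith

/-- For every `C ≥ 1` there is `ε > 0` such that for every Euclidean
triangle `T` (convex hull of three affinely independent points) whose product of interior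
angles is `< ε`, every center `x₀ ∈ ℝ²` and every `r > 10 · diam T`, there is a measurable
set `F ⊆ B(x₀,r)` of positive measure with
`|{x : M_{L_r(T)} 1_F (x) ≥ 1/4}| ≥ C · |F|`. -/
theorem statement10 :
    ∀ C : ℝ, 1 ≤ C → ∃ ε : ℝ, 0 < ε ∧
      ∀ a b c : Plane, AffineIndependent ℝ ![a, b, c] →
        ∠ b a c * ∠ a b c * ∠ a c b < ε →
        ∀ (x₀ : Plane) (r : ℝ), 10 * Metric.diam (convexHull ℝ {a, b, c}) < r →
          ∃ F : Set Plane, F ⊆ ball x₀ r ∧ MeasurableSet F ∧ 0 < volume F ∧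
            ENNReal.ofReal C * volume F ≤
              volume {x | (1 / 4 : ℝ≥0∞) ≤
                maximalFn volume (localFamily (convexHull ℝ {a, b, c}) x₀ r)
                  (F.indicator fun _ => (1 : ℝ)) x} := by
  intro C hC
  obtain ⟨ε, hε, hmain⟩ := exists_large_levelSet hC
  refine ⟨ε ^ 3, by positivity, fun a b c hind hangle x₀ r hr => ?_⟩
  obtain ⟨d, s, h, hd, hs, hsd, hh, hhε, hdiam, hg⟩ := exists_normal_form hε hind hangle
  have hfin : ({0, !₂[d, 0], !₂[s, h]} : Set Plane).Finite := Set.toFinite _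
  refine hmain d |h| (normalTriangle d s h) _ hd (abs_pos.mpr hh) hhε (convex_convexHull ℝ _)
    (hfin.isCompact_convexHull ℝ) (subset_convexHull ℝ _ (by simp))
    (subset_convexHull ℝ _ (by simp)) (fun q hq => normalTriangle_bounds hs hsd hq) ?_ hg x₀ r
    (by linarith)
  have := le_volume_normalTriangle d s h
  rwa [abs_mul, abs_of_pos hd] at this
end

section
/- For every constant A ≥ 1 there exists a finite family of rectangles {R_i : i ∈ I} in ℝ² such that |⋃_{i∈I} T R_i| ≥ A · |⋃_{i∈I} R_i|, where for a rectangle R, T R denotes the translate of R along the direction of its longest side by its own length (i.e., if R is the image of [0,a]×[0,b] with a ≥ b under a rotation ρ followed by a translation, then T R = R + ρ(a, 0)). -/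
open MeasureTheory
open scoped ENNReal

/-- The axis-parallel rectangle `[0,a] × [0,b]` in the plane `ℂ ≅ ℝ²`. -/
def baseRect (a b : ℝ) : Set ℂ :=
  {z : ℂ | z.re ∈ Set.Icc 0 a ∧ z.im ∈ Set.Icc 0 b}

open Finset

/-- The affine function `t ↦ ∑ j < N, d j * N⁻⁽ʲ⁺¹⁾ * (t - j / N)`, whose slope has the base-`N`
digits `d 0, …, d (N - 1)`. -/
noncomputable def digitLine (N : ℕ) (d : ℕ → ℕ) (t : ℝ) : ℝ :=
  ∑ j ∈ range N, (d j : ℝ) / (N : ℝ) ^ (j + 1) * (t - j / N)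

/-- The slope of `digitLine N d`. -/
noncomputable def digitSlope (N : ℕ) (d : ℕ → ℕ) : ℝ :=
  ∑ j ∈ range N, (d j : ℝ) / (N : ℝ) ^ (j + 1)

/-- Extension by zero of a finite sequence of digits. -/
def extendDigits {N : ℕ} (d : Fin N → Fin N) (j : ℕ) : ℕ :=
  if h : j < N then d ⟨j, h⟩ else 0

lemma extendDigits_lt {N : ℕ} (hN : 0 < N) (d : Fin N → Fin N) (j : ℕ) :
    extendDigits d j < N := by
  unfold extendDigits
  split_ifs
  · exact Fin.is_lt _
  · exact hN

lemma extendDigits_injective {N : ℕ} :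
    Function.Injective (extendDigits : (Fin N → Fin N) → ℕ → ℕ) := by
  intro d e h
  ext j
  simpa [extendDigits] using congrFun h j

lemma digitLine_eq_add_slope_mul (N : ℕ) (d : ℕ → ℕ) (t : ℝ) :
    digitLine N d t = digitLine N d 0 + digitSlope N d * t := by
  unfold digitLine digitSlope
  rw [sum_mul, ← sum_add_distrib]
  exact sum_congr rfl fun j _ => by ring

lemma continuous_digitLine (N : ℕ) (d : ℕ → ℕ) : Continuous (digitLine N d) := by
  unfold digitLine
  fun_prop

/-- A telescoping geometric sum. -/
lemma sum_Ico_pred_div_pow {N : ℕ} (hN : 0 < N) {k l : ℕ} (hkl : k ≤ l) :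
    ∑ j ∈ Ico k l, ((N : ℝ) - 1) / (N : ℝ) ^ (j + 1) = 1 / (N : ℝ) ^ k - 1 / (N : ℝ) ^ l := by
  have hN' : (N : ℝ) ≠ 0 := by positivity
  induction l, hkl using Nat.le_induction with
  | base => simp
  | succ l hl ih =>
    rw [sum_Ico_succ_top hl, ih]
    field_simp
    ring

lemma digit_le_pred {N a : ℕ} (h : a < N) : (a : ℝ) ≤ N - 1 := by
  have : (a : ℝ) + 1 ≤ N := by exact_mod_cast h
  linarith

lemma digitSlope_nonneg (N : ℕ) (d : ℕ → ℕ) : 0 ≤ digitSlope N d :=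
  sum_nonneg fun _ _ => by positivity

lemma digitSlope_le_one {N : ℕ} (hN : 0 < N) {d : ℕ → ℕ} (hd : ∀ j, d j < N) :
    digitSlope N d ≤ 1 := by
  calc digitSlope N d ≤ ∑ j ∈ range N, ((N : ℝ) - 1) / (N : ℝ) ^ (j + 1) :=
        sum_le_sum fun j _ => by gcongr; exact digit_le_pred (hd j)
    _ = 1 - 1 / (N : ℝ) ^ N := by
        rw [range_eq_Ico, sum_Ico_pred_div_pow hN (Nat.zero_le _)]; simp
    _ ≤ 1 := by
        have : (0 : ℝ) ≤ 1 / (N : ℝ) ^ N := by positivity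
        linarith

lemma sum_range_split {N k : ℕ} (hk : k < N) (g : ℕ → ℝ) :
    ∑ j ∈ range N, g j = ∑ j ∈ range k, g j + g k + ∑ j ∈ Ico (k + 1) N, g j := by
  rw [← sum_range_succ, sum_range_add_sum_Ico _ hk]

lemma node_le_one {N j : ℕ} (hj : j < N) : (j : ℝ) / N ≤ 1 :=
  div_le_one_of_le₀ (by exact_mod_cast hj.le) (by positivity)

/-- Near the node `k / N` the value of `digitLine N d` is determined by the first `k` digits up to
an error `3 / N ^ (k + 1)`. -/
lemma abs_digitLine_sub_initial_le {N k : ℕ} (hk : k < N) {d : ℕ → ℕ} (hd : ∀ j, d j < N) {t : ℝ}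
    (ht : |t - k / N| ≤ 1 / N) (htl : -1 ≤ t) (htu : t ≤ 1) :
    |digitLine N d t - ∑ j ∈ range k, (d j : ℝ) / (N : ℝ) ^ (j + 1) * (t - j / N)|
      ≤ 3 / (N : ℝ) ^ (k + 1) := by
  have hN : 0 < N := by omega
  have hN' : (0 : ℝ) < N := by exact_mod_cast hN
  rw [digitLine, sum_range_split hk, add_assoc, add_sub_cancel_left]
  have hmid : |(d k : ℝ) / (N : ℝ) ^ (k + 1) * (t - k / N)| ≤ 1 / (N : ℝ) ^ (k + 1) := by
    rw [abs_mul, abs_of_nonneg (by positivity : (0 : ℝ) ≤ (d k : ℝ) / (N : ℝ) ^ (k + 1))]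
    calc (d k : ℝ) / (N : ℝ) ^ (k + 1) * |t - k / N|
        ≤ (N : ℝ) / (N : ℝ) ^ (k + 1) * (1 / N) := by
          gcongr
          exact_mod_cast (hd k).le
      _ = 1 / (N : ℝ) ^ (k + 1) := by field_simp
  have htail : |∑ j ∈ Ico (k + 1) N, (d j : ℝ) / (N : ℝ) ^ (j + 1) * (t - j / N)|
      ≤ 2 / (N : ℝ) ^ (k + 1) := by
    calc _ ≤ ∑ j ∈ Ico (k + 1) N, |(d j : ℝ) / (N : ℝ) ^ (j + 1) * (t - j / N)| :=
          abs_sum_le_sum_abs _ _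
      _ ≤ ∑ j ∈ Ico (k + 1) N, ((N : ℝ) - 1) / (N : ℝ) ^ (j + 1) * 2 := by
          refine sum_le_sum fun j hj => ?_
          have hjN : (j : ℝ) / N ≤ 1 := node_le_one (mem_Ico.1 hj).2
          have hj0 : (0 : ℝ) ≤ (j : ℝ) / N := by positivity
          have hdj := digit_le_pred (hd j)
          rw [abs_mul, abs_of_nonneg (by positivity : (0 : ℝ) ≤ (d j : ℝ) / (N : ℝ) ^ (j + 1))]
          have habs : |t - j / N| ≤ 2 := abs_le.2 ⟨by linarith, by linarith⟩
          have : (0 : ℝ) ≤ N - 1 := le_trans (by positivity) hdj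
          gcongr
      _ = (1 / (N : ℝ) ^ (k + 1) - 1 / (N : ℝ) ^ N) * 2 := by
          rw [← sum_mul, sum_Ico_pred_div_pow hN hk]
      _ ≤ 2 / (N : ℝ) ^ (k + 1) := by
          have : (0 : ℝ) ≤ 1 / (N : ℝ) ^ N := by positivity
          have h2 : 2 / (N : ℝ) ^ (k + 1) = 1 / (N : ℝ) ^ (k + 1) * 2 := by ring
          linarith
  calc _ ≤ _ := abs_add_le _ _
    _ ≤ 1 / (N : ℝ) ^ (k + 1) + 2 / (N : ℝ) ^ (k + 1) := add_le_add hmid htail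
    _ = 3 / (N : ℝ) ^ (k + 1) := by ring

lemma exists_node_near {N : ℕ} (hN : 0 < N) {t : ℝ} (htl : -(1 / N) ≤ t) (htu : t ≤ 1) :
    ∃ k < N, |t - k / N| ≤ 1 / N := by
  have hN' : (0 : ℝ) < N := by exact_mod_cast hN
  rcases lt_or_ge t 0 with h0 | h0
  · exact ⟨0, hN, by simp only [Nat.cast_zero, zero_div, sub_zero]; rw [abs_of_neg h0]; linarith⟩
  rcases htu.lt_or_eq with h1 | rfl
  · have hlt : ⌊t * N⌋₊ < N := by
      rw [Nat.floor_lt (by positivity)]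
      nlinarith
    refine ⟨⌊t * N⌋₊, hlt, ?_⟩
    have hle := Nat.floor_le (by positivity : 0 ≤ t * N)
    have hlt' := Nat.lt_floor_add_one (t * N)
    have heq : t - (⌊t * N⌋₊ : ℝ) / N = (t * N - ⌊t * N⌋₊) / N := by field_simp
    rw [heq, abs_of_nonneg (div_nonneg (by linarith) hN'.le)]
    gcongr
    linarith
  · refine ⟨N - 1, by omega, ?_⟩
    have heq : (1 : ℝ) - ((N - 1 : ℕ) : ℝ) / N = 1 / N := by
      rw [Nat.cast_sub hN]
      field_simp
      push_cast
      ring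
    rw [heq, abs_of_nonneg (by positivity)]

/-- For `t ≤ 1` the intervals above the values of the digit lines overlap heavily. -/
lemma volume_iUnion_digitLine_Icc_le {N : ℕ} (hN : 0 < N) {t : ℝ} (htl : -(1 / N) ≤ t)
    (htu : t ≤ 1) :
    volume (⋃ d : Fin N → Fin N, Set.Icc (digitLine N (extendDigits d) t)
      (digitLine N (extendDigits d) t + 2 / (N : ℝ) ^ N)) ≤ ENNReal.ofReal (8 / N) := by
  have hN' : (0 : ℝ) < N := by exact_mod_cast hN
  have hN1 : (1 : ℝ) ≤ N := by exact_mod_cast hN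
  obtain ⟨k, hk, hkt⟩ := exists_node_near hN htl htu
  have htl' : -1 ≤ t := by
    have : 1 / (N : ℝ) ≤ 1 := div_le_one_of_le₀ hN1 hN'.le
    linarith
  let P : (Fin k → Fin N) → ℝ := fun e => ∑ j : Fin k, (e j : ℝ) / (N : ℝ) ^ ((j : ℕ) + 1) *
    (t - (j : ℕ) / N)
  have hsub : (⋃ d : Fin N → Fin N, Set.Icc (digitLine N (extendDigits d) t)
      (digitLine N (extendDigits d) t + 2 / (N : ℝ) ^ N)) ⊆
      ⋃ e : Fin k → Fin N, Set.Icc (P e - 3 / (N : ℝ) ^ (k + 1)) (P e + 5 / (N : ℝ) ^ (k + 1)) := by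
    refine Set.iUnion_subset fun d => ?_
    refine Set.subset_iUnion_of_subset (fun j => d (Fin.castLE hk.le j)) ?_
    have hP : P (fun j => d (Fin.castLE hk.le j)) =
        ∑ j ∈ range k, (extendDigits d j : ℝ) / (N : ℝ) ^ (j + 1) * (t - j / N) := by
      rw [sum_range]
      refine sum_congr rfl fun j _ => ?_
      have : (j : ℕ) < N := j.is_lt.trans hk
      simp [extendDigits, this, Fin.castLE]
    have h := abs_le.1 (abs_digitLine_sub_initial_le hk (extendDigits_lt hN d) hkt htl' htu)
    rw [← hP] at h
    have h2 : 2 / (N : ℝ) ^ N ≤ 2 / (N : ℝ) ^ (k + 1) := by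
      gcongr
      exact hk
    have h5 : 5 / (N : ℝ) ^ (k + 1) = 3 / (N : ℝ) ^ (k + 1) + 2 / (N : ℝ) ^ (k + 1) := by ring
    exact Set.Icc_subset_Icc (by linarith [h.1]) (by linarith [h.2])
  calc _ ≤ _ := measure_mono hsub
    _ ≤ _ := measure_iUnion_le _
    _ = ∑ _e : Fin k → Fin N, ENNReal.ofReal (8 / (N : ℝ) ^ (k + 1)) := by
        rw [tsum_fintype]
        refine sum_congr rfl fun e _ => ?_
        rw [Real.volume_Icc]
        congr 1
        ring
    _ = ENNReal.ofReal (8 / N) := by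
        rw [← ENNReal.ofReal_sum_of_nonneg (fun _ _ => by positivity)]
        congr 1
        simp only [sum_const, card_univ, Fintype.card_pi, Fintype.card_fin, prod_const, nsmul_eq_mul,
          Nat.cast_pow]
        field_simp
        ring

/-- To the right of all nodes, lines with distinct digits are separated. -/
lemma digitLine_add_le_of_first_digit_lt {N k : ℕ} (hk : k < N) {d e : ℕ → ℕ}
    (hd : ∀ j, d j < N) (heq : ∀ j < k, d j = e j) (hlt : d k < e k) {t : ℝ} (ht : 3 / 2 ≤ t) :
    digitLine N d t + 1 / 2 / (N : ℝ) ^ N ≤ digitLine N e t := by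
  have hN : 0 < N := by omega
  have hN' : (0 : ℝ) < N := by exact_mod_cast hN
  have hw : (1 : ℝ) / 2 ≤ t - k / N := by linarith [node_le_one hk]
  have hinit : ∑ j ∈ range k, (d j : ℝ) / (N : ℝ) ^ (j + 1) * (t - j / N) =
      ∑ j ∈ range k, (e j : ℝ) / (N : ℝ) ^ (j + 1) * (t - j / N) :=
    sum_congr rfl fun j hj => by rw [heq j (mem_range.1 hj)]
  have hmid : (d k : ℝ) / (N : ℝ) ^ (k + 1) * (t - k / N) + 1 / (N : ℝ) ^ (k + 1) * (t - k / N) ≤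
      (e k : ℝ) / (N : ℝ) ^ (k + 1) * (t - k / N) := by
    rw [← add_mul, ← add_div]
    have : (d k : ℝ) + 1 ≤ e k := by exact_mod_cast hlt
    gcongr
  have htail_d : ∑ j ∈ Ico (k + 1) N, (d j : ℝ) / (N : ℝ) ^ (j + 1) * (t - j / N) ≤
      (1 / (N : ℝ) ^ (k + 1) - 1 / (N : ℝ) ^ N) * (t - k / N) := by
    rw [← sum_Ico_pred_div_pow hN hk, sum_mul]
    refine sum_le_sum fun j hj => ?_
    have hj1 := node_le_one (mem_Ico.1 hj).2
    have hdj := digit_le_pred (hd j)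
    have hkj : (k : ℝ) ≤ j := by exact_mod_cast (Nat.le_of_succ_le (mem_Ico.1 hj).1)
    have : (0 : ℝ) ≤ N - 1 := le_trans (by positivity) hdj
    have : 0 ≤ t - j / N := by linarith
    gcongr
  have htail_e : 0 ≤ ∑ j ∈ Ico (k + 1) N, (e j : ℝ) / (N : ℝ) ^ (j + 1) * (t - j / N) := by
    refine sum_nonneg fun j hj => mul_nonneg (by positivity) ?_
    linarith [node_le_one (mem_Ico.1 hj).2]
  have hlast : 1 / 2 / (N : ℝ) ^ N ≤ 1 / (N : ℝ) ^ N * (t - k / N) := by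
    have : 1 / 2 / (N : ℝ) ^ N = 1 / (N : ℝ) ^ N * (1 / 2) := by ring
    rw [this]
    gcongr
  rw [digitLine, digitLine, sum_range_split hk, sum_range_split hk, hinit]
  linarith

/-- For `t ≥ 3 / 2` the intervals above the values of the digit lines are disjoint. -/
lemma le_volume_iUnion_digitLine_Ico {N : ℕ} (hN : 0 < N) {t : ℝ} (ht : 3 / 2 ≤ t) :
    ENNReal.ofReal (1 / 2) ≤ volume (⋃ d : Fin N → Fin N, Set.Ico (digitLine N (extendDigits d) t)
      (digitLine N (extendDigits d) t + 1 / 2 / (N : ℝ) ^ N)) := by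
  have hN' : (0 : ℝ) < N := by exact_mod_cast hN
  have hdisj : Pairwise (Function.onFun Disjoint fun d : Fin N → Fin N =>
      Set.Ico (digitLine N (extendDigits d) t)
        (digitLine N (extendDigits d) t + 1 / 2 / (N : ℝ) ^ N)) := by
    intro d e hde
    have hex : ∃ k, extendDigits d k ≠ extendDigits e k :=
      Function.ne_iff.1 (extendDigits_injective.ne hde)
    classical
    have hspec := Nat.find_spec hex
    have hmin : ∀ j < Nat.find hex, extendDigits d j = extendDigits e j :=
      fun j hj => not_not.1 (Nat.find_min hex hj)
    have hk : Nat.find hex < N := by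
      by_contra h
      exact hspec (by rw [extendDigits, extendDigits, dif_neg h, dif_neg h])
    rw [Function.onFun, Set.disjoint_left]
    intro y hyd hye
    rcases hspec.lt_or_gt with h | h
    · have := digitLine_add_le_of_first_digit_lt hk (extendDigits_lt hN d) hmin h ht
      linarith [hyd.2, hye.1]
    · have := digitLine_add_le_of_first_digit_lt hk (extendDigits_lt hN e)
        (fun j hj => (hmin j hj).symm) h ht
      linarith [hye.2, hyd.1]
  rw [measure_iUnion hdisj fun _ => measurableSet_Ico, tsum_fintype]
  simp only [Real.volume_Ico, add_sub_cancel_left]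
  rw [← ENNReal.ofReal_sum_of_nonneg (fun _ _ => by positivity)]
  refine ENNReal.ofReal_le_ofReal (le_of_eq ?_)
  simp only [sum_const, card_univ, Fintype.card_pi, Fintype.card_fin, prod_const, nsmul_eq_mul,
    Nat.cast_pow]
  field_simp

/-- A planar set is bounded in area by its width times the largest length of a vertical slice. -/
lemma volume_le_of_slices_le {S : Set (ℝ × ℝ)} (hS : MeasurableSet S) {x y : ℝ} {c : ℝ≥0∞}
    (hproj : ∀ p ∈ S, p.1 ∈ Set.Icc x y)
    (hc : ∀ t ∈ Set.Icc x y, volume (Prod.mk t ⁻¹' S) ≤ c) :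
    volume S ≤ c * ENNReal.ofReal (y - x) := by
  rw [Measure.volume_eq_prod, Measure.prod_apply hS, ← Real.volume_Icc,
    ← lintegral_indicator_const measurableSet_Icc]
  refine lintegral_mono fun t => ?_
  by_cases ht : t ∈ Set.Icc x y
  · simpa [Set.indicator_of_mem ht] using hc t ht
  · have : Prod.mk t ⁻¹' S = ∅ := Set.eq_empty_of_forall_notMem fun s hs => ht (hproj _ hs)
    simp [this]

lemma le_volume_of_le_slices {S : Set (ℝ × ℝ)} (hS : MeasurableSet S) {x y : ℝ} {c : ℝ≥0∞}
    (hc : ∀ t ∈ Set.Icc x y, c ≤ volume (Prod.mk t ⁻¹' S)) :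
    c * ENNReal.ofReal (y - x) ≤ volume S := by
  rw [Measure.volume_eq_prod, Measure.prod_apply hS, ← Real.volume_Icc,
    ← lintegral_indicator_const measurableSet_Icc]
  refine lintegral_mono fun t => ?_
  by_cases ht : t ∈ Set.Icc x y
  · simpa [Set.indicator_of_mem ht] using hc t ht
  · simp [Set.indicator_of_notMem ht]

/-- The unit vector of slope `s`. -/
noncomputable def slopeDir (s : ℝ) : ℂ := ⟨1 / √(1 + s ^ 2), s / √(1 + s ^ 2)⟩

lemma sqrt_one_add_sq_pos (s : ℝ) : 0 < √(1 + s ^ 2) := Real.sqrt_pos.2 (by positivity)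

lemma norm_slopeDir (s : ℝ) : ‖slopeDir s‖ = 1 := by
  have h := sqrt_one_add_sq_pos s
  have h2 : √(1 + s ^ 2) ^ 2 = 1 + s ^ 2 := Real.sq_sqrt (by positivity)
  rw [← sq_eq_sq₀ (norm_nonneg _) zero_le_one, ← Complex.normSq_eq_norm_sq, Complex.normSq_apply]
  simp only [slopeDir]
  field_simp
  linarith

/-- A thin rectangle along the graph of `t ↦ c + s t` over `[0, 1]` lies in a vertical
neighbourhood of this graph. -/
lemma slopeDir_rect_mem {s c β : ℝ} (hs : 0 ≤ s) (hs1 : s ≤ 1) {z : ℂ}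
    (hz : z ∈ baseRect (√(1 + s ^ 2)) (√(1 + s ^ 2) * β)) :
    (slopeDir s * z + ⟨0, c⟩).re ∈ Set.Icc (-β) 1 ∧
      (slopeDir s * z + ⟨0, c⟩).im ∈ Set.Icc (c + s * (slopeDir s * z + ⟨0, c⟩).re)
        (c + s * (slopeDir s * z + ⟨0, c⟩).re + 2 * β) := by
  obtain ⟨⟨hx0, hx1⟩, hy0, hy1⟩ := hz
  have h := sqrt_one_add_sq_pos s
  set r := √(1 + s ^ 2)
  obtain ⟨p, hp⟩ : ∃ p, z.re = r * p := ⟨z.re / r, by field_simp⟩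
  obtain ⟨q, hq⟩ : ∃ q, z.im = r * q := ⟨z.im / r, by field_simp⟩
  have hre : (slopeDir s * z + ⟨0, c⟩).re = p - s * q := by
    simp only [slopeDir, Complex.add_re, Complex.mul_re, hp, hq]
    change 1 / r * (r * p) - s / r * (r * q) + 0 = _
    field_simp
    ring
  have him : (slopeDir s * z + ⟨0, c⟩).im = c + s * p + q := by
    simp only [slopeDir, Complex.add_im, Complex.mul_im, hp, hq]
    change 1 / r * (r * q) + s / r * (r * p) + c = _
    field_simp
    ring
  rw [hre, him]
  have hp0 : 0 ≤ p := by rw [hp] at hx0; exact nonneg_of_mul_nonneg_right hx0 h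
  have hq0 : 0 ≤ q := by rw [hq] at hy0; exact nonneg_of_mul_nonneg_right hy0 h
  have hp1 : p ≤ 1 := by rw [hp] at hx1; exact le_of_mul_le_mul_left (by linarith) h
  have hqβ : q ≤ β := by rw [hq] at hy1; exact le_of_mul_le_mul_left hy1 h
  have hsq : 0 ≤ s * q := mul_nonneg hs hq0
  have hsq1 : s * q ≤ q := mul_le_of_le_one_left hq0 hs1
  have hssq : s * (s * q) ≤ s * q := mul_le_of_le_one_left hsq hs1
  have hssq0 : 0 ≤ s * (s * q) := mul_nonneg hs hsq
  refine ⟨⟨by linarith, by linarith⟩, ?_, ?_⟩ <;> rw [mul_sub] <;> linarith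

/-- The translate of the rectangle of `slopeDir_rect_mem` contains a vertical neighbourhood of the
graph over `[3 / 2, 7 / 4]`. -/
lemma mem_translate_slopeDir_rect {s c β : ℝ} (hs : 0 ≤ s) (hs1 : s ≤ 1) (hβ : β ≤ 1 / 4) {w : ℂ}
    (hw : w.re ∈ Set.Icc (3 / 2 : ℝ) (7 / 4)) (hwl : c + s * w.re ≤ w.im)
    (hwu : w.im ≤ c + s * w.re + β) :
    w ∈ (fun z => slopeDir s * z + ⟨0, c⟩ + slopeDir s * (√(1 + s ^ 2) : ℂ)) ''
      baseRect (√(1 + s ^ 2)) (√(1 + s ^ 2) * β) := by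
  have h := sqrt_one_add_sq_pos s
  have hs2 : (0 : ℝ) < 1 + s ^ 2 := by positivity
  obtain ⟨q, hq⟩ : ∃ q, w.im - (c + s * w.re) = (1 + s ^ 2) * q :=
    ⟨(w.im - (c + s * w.re)) / (1 + s ^ 2), by field_simp⟩
  have hq0 : 0 ≤ q := nonneg_of_mul_nonneg_right (by linarith) hs2
  have hqβ : q ≤ β := by nlinarith [mul_nonneg (sq_nonneg s) hq0]
  have hsq : 0 ≤ s * q := mul_nonneg hs hq0
  have hsq1 : s * q ≤ q := mul_le_of_le_one_left hq0 hs1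
  set r := √(1 + s ^ 2)
  refine ⟨⟨r * (w.re + s * q - 1), r * q⟩, ⟨⟨?_, ?_⟩, ?_, ?_⟩, ?_⟩
  · exact mul_nonneg h.le (by linarith [hw.1])
  · exact mul_le_of_le_one_right h.le (by linarith [hw.2])
  · exact mul_nonneg h.le hq0
  · exact mul_le_mul_of_nonneg_left hqβ h.le
  · apply Complex.ext
    · simp only [slopeDir, Complex.add_re, Complex.mul_re, Complex.ofReal_re, Complex.ofReal_im]
      change 1 / r * (r * (w.re + s * q - 1)) - s / r * (r * q) + 0 + (1 / r * r - s / r * 0) = _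
      field_simp
      ring
    · simp only [slopeDir, Complex.add_im, Complex.mul_im, Complex.ofReal_re, Complex.ofReal_im]
      change 1 / r * (r * q) + s / r * (r * (w.re + s * q - 1)) + c + (1 / r * 0 + s / r * r) = _
      field_simp
      linear_combination -r * hq

/-- **Kakeya blow with rectangles.** For every `A ≥ 1` there is a (nonempty)
finite family of rectangles `R i` in `ℝ² ≅ ℂ` — each the image of `[0, a i] × [0, b i]` with
`a i ≥ b i > 0` under the rotation `z ↦ u i * z` (`‖u i‖ = 1`) followed by the translation by
`v i` — such that `|⋃ i, T (R i)| ≥ A · |⋃ i, R i|`, where `T R` is `R` translated along the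
direction of its longest side by its own length, i.e. `T (R i) = R i + u i * a i`. -/
theorem statement12 :
    ∀ A : ℝ, 1 ≤ A → ∃ (n : ℕ) (a b : Fin n → ℝ) (u v : Fin n → ℂ), 0 < n ∧
      (∀ i, 0 < b i ∧ b i ≤ a i ∧ ‖u i‖ = 1) ∧
      ENNReal.ofReal A *
          volume (⋃ i, (fun z => u i * z + v i) '' baseRect (a i) (b i)) ≤
        volume (⋃ i, (fun z => u i * z + v i + u i * (a i : ℂ)) '' baseRect (a i) (b i)) := by
  intro A hA
  obtain ⟨N, hNA⟩ := exists_nat_ge (128 * A)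
  have hN4 : (4 : ℝ) ≤ N := by linarith
  have hN' : (0 : ℝ) < N := by linarith
  have hN : 0 < N := by exact_mod_cast hN'
  have hN1 : (1 : ℝ) ≤ N := by linarith
  let σ := (Fintype.equivFin (Fin N → Fin N)).symm
  let β : ℝ := 1 / (N : ℝ) ^ N
  have hβ0 : 0 < β := by positivity
  have hβN : β ≤ 1 / N := by
    refine one_div_le_one_div_of_le hN' ?_
    exact le_self_pow₀ hN1 hN.ne'
  have hN14 : 1 / (N : ℝ) ≤ 1 / 4 := one_div_le_one_div_of_le (by norm_num) hN4
  have hβ4 : β ≤ 1 / 4 := hβN.trans hN14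
  let D : Fin (Fintype.card (Fin N → Fin N)) → ℕ → ℕ := fun i => extendDigits (σ i)
  let s : Fin (Fintype.card (Fin N → Fin N)) → ℝ := fun i => digitSlope N (D i)
  have hs0 : ∀ i, 0 ≤ s i := fun i => digitSlope_nonneg N (D i)
  have hs1 : ∀ i, s i ≤ 1 := fun i => digitSlope_le_one hN (extendDigits_lt hN (σ i))
  let U : Set (ℝ × ℝ) := ⋃ d : Fin N → Fin N, {p | p.1 ∈ Set.Icc (-(1 / N : ℝ)) 1 ∧
    p.2 ∈ Set.Icc (digitLine N (extendDigits d) p.1)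
      (digitLine N (extendDigits d) p.1 + 2 / (N : ℝ) ^ N)}
  let L : Set (ℝ × ℝ) := ⋃ d : Fin N → Fin N, {p | p.1 ∈ Set.Icc (3 / 2 : ℝ) (7 / 4) ∧
    p.2 ∈ Set.Ico (digitLine N (extendDigits d) p.1)
      (digitLine N (extendDigits d) p.1 + 1 / 2 / (N : ℝ) ^ N)}
  have hmeas : ∀ d : Fin N → Fin N, Measurable fun p : ℝ × ℝ =>
      digitLine N (extendDigits d) p.1 :=
    fun d => (continuous_digitLine N _).measurable.comp measurable_fst
  have hU : MeasurableSet U := MeasurableSet.iUnion fun d =>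
    (measurable_fst measurableSet_Icc).inter
      ((measurableSet_le (hmeas d) measurable_snd).inter
        (measurableSet_le measurable_snd ((hmeas d).add_const _)))
  have hL : MeasurableSet L := MeasurableSet.iUnion fun d =>
    (measurable_fst measurableSet_Icc).inter
      ((measurableSet_le (hmeas d) measurable_snd).inter
        (measurableSet_lt measurable_snd ((hmeas d).add_const _)))
  have hUvol : volume U ≤ ENNReal.ofReal (8 / N) * ENNReal.ofReal (1 - -(1 / N)) := by
    refine volume_le_of_slices_le hU (fun p hp => ?_) fun t ht => ?_
    · obtain ⟨d, hd⟩ := Set.mem_iUnion.1 hp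
      exact hd.1
    · refine (measure_mono ?_).trans (volume_iUnion_digitLine_Icc_le hN ht.1 ht.2)
      intro y hy
      obtain ⟨d, hd⟩ := Set.mem_iUnion.1 hy
      exact Set.mem_iUnion.2 ⟨d, hd.2⟩
  have hLvol : ENNReal.ofReal (1 / 2) * ENNReal.ofReal (7 / 4 - 3 / 2) ≤ volume L := by
    refine le_volume_of_le_slices hL fun t ht => ?_
    refine (le_volume_iUnion_digitLine_Ico hN ht.1).trans (measure_mono ?_)
    intro y hy
    obtain ⟨d, hd⟩ := Set.mem_iUnion.1 hy
    exact Set.mem_iUnion.2 ⟨d, ht, hd⟩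
  have hpres := Complex.volume_preserving_equiv_real_prod
  refine ⟨Fintype.card (Fin N → Fin N), fun i => √(1 + s i ^ 2), fun i => √(1 + s i ^ 2) * β,
    fun i => slopeDir (s i), fun i => ⟨0, digitLine N (D i) 0⟩, ?_, fun i => ⟨?_, ?_, ?_⟩, ?_⟩
  · have : Nonempty (Fin N) := ⟨⟨0, hN⟩⟩
    exact Fintype.card_pos
  · exact mul_pos (sqrt_one_add_sq_pos _) hβ0
  · exact mul_le_of_le_one_right (sqrt_one_add_sq_pos _).le (by linarith)
  · exact norm_slopeDir _
  calc _ ≤ ENNReal.ofReal A * volume (Complex.measurableEquivRealProd ⁻¹' U) := by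
        gcongr
        refine Set.iUnion_subset fun i => ?_
        rintro _ ⟨z, hz, rfl⟩
        obtain ⟨hre, him⟩ := slopeDir_rect_mem (c := digitLine N (D i) 0) (hs0 i) (hs1 i) hz
        refine Set.mem_iUnion.2 ⟨σ i, ⟨le_trans (by linarith) hre.1, hre.2⟩, ?_⟩
        have h2 : 2 * β = 2 / (N : ℝ) ^ N := by simp only [β]; ring
        rw [h2, ← digitLine_eq_add_slope_mul] at him
        exact him
    _ = ENNReal.ofReal A * volume U := by rw [hpres.measure_preimage hU.nullMeasurableSet]
    _ ≤ ENNReal.ofReal A * (ENNReal.ofReal (8 / N) * ENNReal.ofReal (1 - -(1 / N))) := by gcongr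
    _ ≤ ENNReal.ofReal (1 / 2) * ENNReal.ofReal (7 / 4 - 3 / 2) := by
        rw [← ENNReal.ofReal_mul (by positivity), ← ENNReal.ofReal_mul (by positivity),
          ← ENNReal.ofReal_mul (by positivity)]
        refine ENNReal.ofReal_le_ofReal ?_
        have h8 : A * (8 / N) ≤ 1 / 16 := by
          rw [mul_div_assoc', div_le_iff₀ hN']
          linarith
        have h8' : 0 ≤ A * (8 / N) := by positivity
        rw [← mul_assoc]
        nlinarith
    _ ≤ volume L := hLvol
    _ = volume (Complex.measurableEquivRealProd ⁻¹' L) :=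
        (hpres.measure_preimage hL.nullMeasurableSet).symm
    _ ≤ _ := by
        refine measure_mono fun w hw => ?_
        obtain ⟨d, hre, hl, hu⟩ := Set.mem_iUnion.1 hw
        obtain ⟨i, rfl⟩ := σ.surjective d
        refine Set.mem_iUnion.2 ⟨i, ?_⟩
        change digitLine N (D i) w.re ≤ w.im at hl
        change w.im < digitLine N (D i) w.re + 1 / 2 / (N : ℝ) ^ N at hu
        rw [digitLine_eq_add_slope_mul] at hl hu
        have hβ2 : 1 / 2 / (N : ℝ) ^ N = β / 2 := by simp only [β]; ring
        refine mem_translate_slopeDir_rect (hs0 i) (hs1 i) hβ4 hre hl ?_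
        linarith
end
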